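/- arXiv:1706.05496 — 3 statements merged into one kernel-verified Lean document; each statement's English description precedes it below -/
import Mathlib

section
/- (Yannakakis factorization theorem) Let P = {x ∈ ℝ^d : Ax ≤ b} be a polytope of dimension at least one, where A ∈ ℝ^{m×d} and b ∈ ℝ^m, let V = {v₁,…,vₙ} ⊆ P be a finite set containing all vertices of P (so P = conv(V)), and let S ∈ ℝ^{m×n} be the slack matrix with entries S_{i,j} = b_i − A_iᵀ v_j. Then for every positive integer r, the following are equivalent: (i) nrank(S) ≤ r; (ii) P has an extension of size at most r; (iii) there exist matrices E ∈ ℝ^{p×d}, F ∈ ℝ^{p×q} with q ≤ r and a vector g ∈ ℝ^p such that P = {x ∈ ℝ^d : ∃ t ∈ ℝ^q with Ex + Ft = g and t ≥ 0}. In particular xc(P) = nrank(S). -/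
/-- The nonnegative rank of a real matrix: the least `r` such that `S = T * U` with
`T`, `U` entrywise nonnegative. -/
noncomputable def nrank {m n : Type*} [Fintype m] [Fintype n] (S : Matrix m n ℝ) : ℕ :=
  sInf {r : ℕ | ∃ T : Matrix m (Fin r) ℝ, ∃ U : Matrix (Fin r) n ℝ,
    (∀ i j, 0 ≤ T i j) ∧ (∀ i j, 0 ≤ U i j) ∧ S = T * U}

/-- A polytope is the convex hull of a finite set of points. -/
def IsPolytope {E : Type*} [AddCommGroup E] [Module ℝ E] (P : Set E) : Prop :=
  ∃ F : Set E, F.Finite ∧ P = convexHull ℝ F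

/-- An (exposed) face of a set `Q ⊆ ℝ^κ`. -/
def IsExposedFace {κ : Type*} [Fintype κ] (Q F : Set (κ → ℝ)) : Prop :=
  F ⊆ Q ∧ ∃ (c : κ → ℝ) (α : ℝ), (∀ y ∈ Q, ∑ i, c i * y i ≤ α) ∧
    F = {y ∈ Q | ∑ i, c i * y i = α}

/-- A facet of `Q`: a maximal proper nonempty face of `Q`. -/
def IsFacet {κ : Type*} [Fintype κ] (Q F : Set (κ → ℝ)) : Prop :=
  IsExposedFace Q F ∧ F.Nonempty ∧ F ≠ Q ∧
    ∀ F' : Set (κ → ℝ), IsExposedFace Q F' → F'.Nonempty → F' ≠ Q → F ⊆ F' → F' = F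

/-- The size of a polytope: its number of facets. -/
noncomputable def polySize {κ : Type*} [Fintype κ] (Q : Set (κ → ℝ)) : ℕ :=
  {F : Set (κ → ℝ) | IsFacet Q F}.ncard

/-- `Q` is an extension of `P` if `Q` is a polytope and some linear map sends `Q` onto `P`. -/
def IsExtension {ι κ : Type*} [Fintype ι] [Fintype κ]
    (P : Set (ι → ℝ)) (Q : Set (κ → ℝ)) : Prop :=
  IsPolytope Q ∧ ∃ π : (κ → ℝ) →ₗ[ℝ] (ι → ℝ), π '' Q = P

/-- The extension complexity of `P`: the minimum number of facets of an extension of `P`. -/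
noncomputable def xc {ι : Type*} [Fintype ι] (P : Set (ι → ℝ)) : ℕ :=
  sInf {r : ℕ | ∃ (k : ℕ) (Q : Set (Fin k → ℝ)), IsExtension P Q ∧ polySize Q = r}

namespace Yann

set_option linter.unusedSectionVars false

theorem farkas {V : Type*} [AddCommGroup V] [Module ℝ V] :
    ∀ (q : ℕ) (ψ : Fin q → V →ₗ[ℝ] ℝ) (φ : V →ₗ[ℝ] ℝ),
      (∀ x, (∀ k, 0 ≤ ψ k x) → 0 ≤ φ x) →
      ∃ c : Fin q → ℝ, (∀ k, 0 ≤ c k) ∧ ∀ x, φ x = ∑ k, c k * ψ k x := by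
  intro q
  induction q with
  | zero =>
    intro ψ φ h
    refine ⟨fun _ => 0, fun _ => le_rfl, fun x => ?_⟩
    have h1 := h x (fun k => k.elim0)
    have h2 := h (-x) (fun k => k.elim0)
    rw [map_neg] at h2
    simp
    linarith
  | succ q ih =>
    intro ψ φ h
    by_cases hc : ∀ x, (∀ k : Fin q, 0 ≤ ψ k.castSucc x) → 0 ≤ φ x
    · obtain ⟨c, hc0, hc⟩ := ih (fun k => ψ k.castSucc) φ hc
      refine ⟨Fin.snoc c 0, fun k => ?_, fun x => ?_⟩
      · refine Fin.lastCases ?_ (fun k => ?_) k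
        · simp
        · simpa using hc0 k
      · rw [Fin.sum_univ_castSucc, hc x]
        simp
    · push Not at hc
      obtain ⟨x0, hx0, hφ0⟩ := hc
      have hβ : ψ (Fin.last q) x0 < 0 := by
        by_contra hn
        push Not at hn
        have := h x0 (fun k => by
          refine Fin.lastCases hn (fun k => hx0 k) k)
        linarith
      set β := ψ (Fin.last q) with hβd
      set s : ℝ := (-(β x0))⁻¹ with hs
      have hspos : 0 < s := inv_pos.mpr (by linarith)
      have hsβ : s * β x0 = -1 := by
        have hne : β x0 ≠ 0 := hβ.ne
        rw [hs]; field_simp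
      obtain ⟨c, hc0, hc⟩ := ih (fun k => ψ k.castSucc + (s * ψ k.castSucc x0) • β)
        (φ + (s * φ x0) • β) (by
          intro x hx
          have := h (x + (s * β x) • x0) (fun k => by
            refine Fin.lastCases ?_ (fun k => ?_) k
            · rw [← hβd, map_add, map_smul, smul_eq_mul]
              have : s * β x * β x0 = β x * (s * β x0) := by ring
              rw [this, hsβ]; linarith
            · have := hx k
              simp only [LinearMap.add_apply, LinearMap.smul_apply, smul_eq_mul] at this
              rw [map_add, map_smul, smul_eq_mul]
              linarith)
          rw [map_add, map_smul, smul_eq_mul] at this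
          simp only [LinearMap.add_apply, LinearMap.smul_apply, smul_eq_mul]
          linarith)
      refine ⟨Fin.snoc c (∑ k, c k * (s * ψ k.castSucc x0) - s * φ x0), fun k => ?_, fun x => ?_⟩
      · refine Fin.lastCases ?_ (fun k => ?_) k
        · simp only [Fin.snoc_last]
          have : 0 ≤ ∑ k, c k * (s * ψ k.castSucc x0) :=
            Finset.sum_nonneg fun k _ => mul_nonneg (hc0 k) (mul_nonneg hspos.le (hx0 k))
          nlinarith
        · simpa using hc0 k
      · have := hc x
        simp only [LinearMap.add_apply, LinearMap.smul_apply, smul_eq_mul, mul_add,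
          Finset.sum_add_distrib] at this
        rw [Fin.sum_univ_castSucc]
        simp only [Fin.snoc_castSucc, Fin.snoc_last, ← hβd]
        rw [sub_mul, Finset.sum_mul]
        have e : ∑ k, c k * (s * ψ k.castSucc x0 * β x)
          = ∑ k, c k * (s * ψ k.castSucc x0) * β x :=
          Finset.sum_congr rfl fun k _ => by ring
        rw [← e]
        linarith

/-- Factorizations over an arbitrary finite index type bound `nrank`. -/
theorem nrank_le_card {m n κ : Type*} [Fintype m] [Fintype n] [Fintype κ]
    (S : Matrix m n ℝ) (T : m → κ → ℝ) (U : κ → n → ℝ)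
    (hT : ∀ i k, 0 ≤ T i k) (hU : ∀ k j, 0 ≤ U k j)
    (h : ∀ i j, S i j = ∑ k, T i k * U k j) : nrank S ≤ Fintype.card κ := by
  let e := (Fintype.equivFin κ).symm
  refine Nat.sInf_le ⟨Matrix.of fun i k => T i (e k), Matrix.of fun k j => U (e k) j, fun i k => hT _ _,
    fun k j => hU _ _, ?_⟩
  ext i j
  rw [h, Matrix.mul_apply]
  exact (Equiv.sum_comp e (fun k => T i k * U k j)).symm

theorem nrank_spec {m n : ℕ} (S : Matrix (Fin m) (Fin n) ℝ) (hS : ∀ i j, 0 ≤ S i j) :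
    ∃ T : Matrix (Fin m) (Fin (nrank S)) ℝ, ∃ U : Matrix (Fin (nrank S)) (Fin n) ℝ,
    (∀ i j, 0 ≤ T i j) ∧ (∀ i j, 0 ≤ U i j) ∧ S = T * U := by
  refine Nat.sInf_mem (s := {r : ℕ | ∃ T : Matrix (Fin m) (Fin r) ℝ, ∃ U : Matrix (Fin r) (Fin n) ℝ,
    (∀ i j, 0 ≤ T i j) ∧ (∀ i j, 0 ≤ U i j) ∧ S = T * U}) ⟨n, S, 1, hS, fun i j => ?_, by simp⟩
  rw [Matrix.one_apply]
  split_ifs <;> norm_num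

/-- Moving slightly beyond a point in the direction away from another one. -/
theorem ext_pt {E ι : Type*} [AddCommGroup E] [Module ℝ E] [Fintype ι]
    (ℓ : ι → E →ₗ[ℝ] ℝ) (z z' : E) (hz : ∀ k, 0 ≤ ℓ k z)
    (h : ∀ k, ℓ k z = 0 → ℓ k z' = 0) :
    ∃ ε : ℝ, 0 < ε ∧ ∀ k, 0 ≤ ℓ k (z + (-ε) • (z' - z)) := by
  have h1 : ∀ k, ∃ ε : ℝ, 0 < ε ∧ ∀ δ : ℝ, 0 < δ → δ ≤ ε → 0 ≤ ℓ k (z + (-δ) • (z' - z)) := by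
    intro k
    rcases (hz k).eq_or_lt with h0 | h0
    · refine ⟨1, one_pos, fun δ _ _ => ?_⟩
      simp [← h0, h k h0.symm]
    · refine ⟨ℓ k z / (|ℓ k (z' - z)| + 1), by positivity, fun δ hδ hle => ?_⟩
      rw [le_div_iff₀ (by positivity)] at hle
      rw [map_add, map_smul, smul_eq_mul]
      have := le_abs_self (ℓ k (z' - z))
      nlinarith
  choose ε hε hε2 using h1
  have : ∃ δ : ℝ, 0 < δ ∧ ∀ k, δ ≤ ε k := by
    rcases isEmpty_or_nonempty ι with hι | hι
    · exact ⟨1, one_pos, fun k => isEmptyElim k⟩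
    · obtain ⟨k0, hk0⟩ := Finite.exists_min ε
      exact ⟨ε k0, hε k0, hk0⟩
  obtain ⟨δ, hδ, hδ2⟩ := this
  exact ⟨δ, hδ, fun k => hε2 k δ hδ (hδ2 k)⟩

section poly
variable {E ι : Type*} [AddCommGroup E] [Module ℝ E] [Fintype ι]

theorem ext_unique (L : Set E) (ℓ : ι → E →ₗ[ℝ] ℝ)
    (hL : ∀ z ∈ L, ∀ z' ∈ L, ∀ a : ℝ, z + a • (z' - z) ∈ L) (z z' : E)
    (hz : z ∈ Set.extremePoints ℝ {y | y ∈ L ∧ ∀ k, 0 ≤ ℓ k y})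
    (hz' : z' ∈ L ∧ ∀ k, 0 ≤ ℓ k z') (h : ∀ k, ℓ k z = 0 → ℓ k z' = 0) : z' = z := by
  obtain ⟨ε, hε, h2⟩ := ext_pt ℓ z z' hz.1.2 h
  have hm : z + (-ε) • (z' - z) ∈ {y | y ∈ L ∧ ∀ k, 0 ≤ ℓ k y} :=
    ⟨hL _ hz.1.1 _ hz'.1 _, h2⟩
  refine (mem_extremePoints.1 hz).2 z' hz' _ hm ?_ |>.1
  refine ⟨ε / (1 + ε), 1 / (1 + ε), by positivity, by positivity, by field_simp; ring, ?_⟩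
  have h1 : (1 + ε) ≠ 0 := by positivity
  match_scalars <;> field_simp <;> ring

theorem poly_convex (L : Set E) (ℓ : ι → E →ₗ[ℝ] ℝ)
    (hL : ∀ z ∈ L, ∀ z' ∈ L, ∀ a : ℝ, z + a • (z' - z) ∈ L) :
    Convex ℝ {y | y ∈ L ∧ ∀ k, 0 ≤ ℓ k y} := by
  intro x hx y hy a b ha hb hab
  refine ⟨?_, fun k => ?_⟩
  · have := hL x hx.1 y hy.1 b
    convert this using 1
    have : a = 1 - b := by linarith
    subst this
    module
  · rw [map_add, map_smul, map_smul]
    exact add_nonneg (mul_nonneg ha (hx.2 k)) (mul_nonneg hb (hy.2 k))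

theorem ext_finite (L : Set E) (ℓ : ι → E →ₗ[ℝ] ℝ)
    (hL : ∀ z ∈ L, ∀ z' ∈ L, ∀ a : ℝ, z + a • (z' - z) ∈ L) :
    (Set.extremePoints ℝ {y | y ∈ L ∧ ∀ k, 0 ≤ ℓ k y}).Finite := by
  refine Set.Finite.of_injOn (f := fun z => {k | ℓ k z = 0}) (t := Set.univ)
    (fun _ _ => Set.mem_univ _) ?_ Set.finite_univ
  intro z hz z' hz' h
  refine (ext_unique L ℓ hL z z' hz hz'.1 fun k hk => ?_).symm
  have : k ∈ {k | ℓ k z = 0} := hk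
  simp only at h
  rw [h] at this
  exact this

theorem poly_hull [TopologicalSpace E] [IsTopologicalAddGroup E] [ContinuousSMul ℝ E]
    [LocallyConvexSpace ℝ E] [T2Space E]
    (L : Set E) (ℓ : ι → E →ₗ[ℝ] ℝ)
    (hL : ∀ z ∈ L, ∀ z' ∈ L, ∀ a : ℝ, z + a • (z' - z) ∈ L)
    (hc : IsCompact {y | y ∈ L ∧ ∀ k, 0 ≤ ℓ k y}) :
    {y | y ∈ L ∧ ∀ k, 0 ≤ ℓ k y} =
      convexHull ℝ (Set.extremePoints ℝ {y | y ∈ L ∧ ∀ k, 0 ≤ ℓ k y}) := by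
  have h := closure_convexHull_extremePoints hc (poly_convex L ℓ hL)
  rw [((ext_finite L ℓ hL).isClosed_convexHull ℝ).closure_eq] at h
  exact h.symm

end poly

/-- Facets of a polyhedron given by `ι` inequalities. -/
theorem facets_le {N : ℕ} {ι : Type*} [Fintype ι] (L : Set (Fin N → ℝ)) (σ : ι → Fin N)
    (hL : ∀ z ∈ L, ∀ z' ∈ L, ∀ a : ℝ, z + a • (z' - z) ∈ L) :
    polySize {y | y ∈ L ∧ ∀ k, 0 ≤ y (σ k)} ≤ Fintype.card ι := by
  classical
  set Q : Set (Fin N → ℝ) := {y | y ∈ L ∧ ∀ k, 0 ≤ y (σ k)} with hQ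
  let ℓ : ι → (Fin N → ℝ) →ₗ[ℝ] ℝ := fun k => LinearMap.proj (σ k)
  have hconvQ : Convex ℝ Q := poly_convex L ℓ hL
  have key : {F | IsFacet Q F} ⊆ Set.range (fun k : ι => {y ∈ Q | y (σ k) = 0}) := by
    rintro G ⟨⟨hGQ, c, α, hle, hG⟩, hGne, hGQne, hmax⟩
    have hGconv : Convex ℝ G := by
      intro x hx y hy a b ha hb hab
      rw [hG] at hx hy ⊢
      refine ⟨hconvQ hx.1 hy.1 ha hb hab, ?_⟩
      have : ∑ i, c i * (a • x + b • y) i = a * ∑ i, c i * x i + b * ∑ i, c i * y i := by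
        rw [Finset.mul_sum, Finset.mul_sum, ← Finset.sum_add_distrib]
        refine Finset.sum_congr rfl fun i _ => ?_
        simp; ring
      rw [this, hx.2, hy.2, ← add_mul, hab, one_mul]
    have hex : ∃ k, {y ∈ Q | y (σ k) = 0} ≠ Q ∧ G ⊆ {y ∈ Q | y (σ k) = 0} := by
      by_contra hno
      push Not at hno
      -- a point of `G` with all non-trivial coordinates positive
      have hpt : ∀ s : Finset ι, ∃ z ∈ G, ∀ k ∈ s, z (σ k) = 0 → ∀ y ∈ Q, y (σ k) = 0 := by
        intro s
        induction s using Finset.induction_on with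
        | empty =>
          obtain ⟨z, hz⟩ := hGne
          exact ⟨z, hz, fun k hk => by simp at hk⟩
        | insert k s hk ih =>
          obtain ⟨z, hz, hz2⟩ := ih
          by_cases hkQ : {y ∈ Q | y (σ k) = 0} = Q
          · refine ⟨z, hz, fun k' hk' h0 y hy => ?_⟩
            rcases Finset.mem_insert.1 hk' with rfl | hk'
            · rw [← hkQ] at hy; exact hy.2
            · exact hz2 k' hk' h0 y hy
          · obtain ⟨g, hgG, hg⟩ := Set.not_subset.1 (hno k hkQ)
            have hg0 : g (σ k) ≠ 0 := fun h0 => hg ⟨hGQ hgG, h0⟩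
            refine ⟨(1/2 : ℝ) • z + (1/2 : ℝ) • g,
              hGconv hz hgG (by norm_num) (by norm_num) (by norm_num), fun k' hk' h0 y hy => ?_⟩
            have p1 := (hGQ hz).2 k'
            have p2 := (hGQ hgG).2 k'
            simp only [Pi.add_apply, Pi.smul_apply, smul_eq_mul] at h0
            rcases Finset.mem_insert.1 hk' with rfl | hk'
            · exact absurd (by linarith) hg0
            · exact hz2 k' hk' (by linarith) y hy
      obtain ⟨z, hzG, hz⟩ := hpt Finset.univ
      apply hGQne
      refine hGQ.antisymm fun w hw => ?_
      obtain ⟨ε, hε, hpos⟩ := ext_pt ℓ z w (hGQ hzG).2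
        (fun k hk => hz k (Finset.mem_univ _) hk w hw)
      have hin : z + (-ε) • (w - z) ∈ Q := ⟨hL _ (hGQ hzG).1 _ hw.1 _, hpos⟩
      have h1 := hle _ hin
      have h2 := hle w hw
      rw [hG] at hzG ⊢
      refine ⟨hw, le_antisymm h2 ?_⟩
      have e : ∑ i, c i * (z + (-ε) • (w - z)) i
          = (1 + ε) * ∑ i, c i * z i - ε * ∑ i, c i * w i := by
        rw [Finset.mul_sum, Finset.mul_sum, ← Finset.sum_sub_distrib]
        refine Finset.sum_congr rfl fun i _ => ?_
        simp; ring
      rw [e, hzG.2] at h1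
      nlinarith
    obtain ⟨k, hk1, hk2⟩ := hex
    refine ⟨k, hmax _ ⟨fun y hy => hy.1, fun i => if i = σ k then -1 else 0, 0, ?_, ?_⟩
      (hGne.mono hk2) hk1 hk2⟩
    · intro y hy
      simpa using hy.2 k
    · ext y; simp
  calc polySize Q ≤ (Set.range (fun k : ι => {y ∈ Q | y (σ k) = 0})).ncard :=
        Set.ncard_le_ncard key (Set.finite_range _)
    _ ≤ Fintype.card ι := by
      rw [← Set.image_univ, ← Nat.card_eq_fintype_card, ← Set.ncard_univ]
      exact Set.ncard_image_le Set.finite_univ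

/-- Barycentric representation. -/
theorem hull_weights {N k : ℕ} (w : Fin N → Fin k → ℝ) (y : Fin k → ℝ)
    (hy : y ∈ convexHull ℝ (Set.range w)) :
    ∃ μ : Fin N → ℝ, (∀ j, 0 ≤ μ j) ∧ ∑ j, μ j = 1 ∧ ∀ i, y i = ∑ j, μ j * w j i := by
  refine convexHull_min (t := {y | ∃ μ : Fin N → ℝ, (∀ j, 0 ≤ μ j) ∧ ∑ j, μ j = 1 ∧
    ∀ i, y i = ∑ j, μ j * w j i}) ?_ ?_ hy
  · rintro _ ⟨j, rfl⟩
    refine ⟨fun l => if l = j then 1 else 0, fun l => ?_, by simp, fun i => by simp⟩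
    dsimp only
    split_ifs <;> norm_num
  · rintro x ⟨μ, h0, h1, h2⟩ y ⟨ν, k0, k1, k2⟩ a b ha hb hab
    refine ⟨fun j => a * μ j + b * ν j,
      fun j => add_nonneg (mul_nonneg ha (h0 j)) (mul_nonneg hb (k0 j)), ?_, fun i => ?_⟩
    · rw [Finset.sum_add_distrib, ← Finset.mul_sum, ← Finset.mul_sum, h1, k1]
      linarith
    · simp only [Pi.add_apply, Pi.smul_apply, smul_eq_mul, h2, k2, Finset.mul_sum,
        ← Finset.sum_add_distrib]
      exact Finset.sum_congr rfl fun j _ => by ring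

theorem hull_affine {N k : ℕ} (w : Fin N → Fin k → ℝ) (y : Fin k → ℝ) (μ : Fin N → ℝ)
    (h1 : ∑ j, μ j = 1) (h2 : ∀ i, y i = ∑ j, μ j * w j i) (c : Fin k → ℝ) (α : ℝ) :
    α - ∑ i, c i * y i = ∑ j, μ j * (α - ∑ i, c i * w j i) := by
  simp only [mul_sub, Finset.sum_sub_distrib, ← Finset.sum_mul, h1, one_mul]
  congr 1
  simp only [h2, Finset.mul_sum]
  rw [Finset.sum_comm]
  exact Finset.sum_congr rfl fun j _ => Finset.sum_congr rfl fun i _ => by ring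

section facets
variable {N k : ℕ} (w : Fin N → Fin k → ℝ)

/-- The restrictions of affine functions to the points `w`, normalized. -/
def affL : Set (Fin N → ℝ) :=
  {f | (∃ (c : Fin k → ℝ) (α : ℝ), ∀ j, f j = α - ∑ i, c i * w j i) ∧ ∑ j, f j = 1}

def cone1 : Set (Fin N → ℝ) :=
  {f | f ∈ affL w ∧ ∀ j, 0 ≤ (LinearMap.proj j : (Fin N → ℝ) →ₗ[ℝ] ℝ) f}

theorem affL_line : ∀ z ∈ affL w, ∀ z' ∈ affL w, ∀ a : ℝ, z + a • (z' - z) ∈ affL w := by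
  rintro z ⟨⟨c, α, h⟩, h1⟩ z' ⟨⟨c', α', h'⟩, h1'⟩ a
  refine ⟨⟨c + a • (c' - c), α + a * (α' - α), fun j => ?_⟩, ?_⟩
  · have : ∑ i, (c + a • (c' - c)) i * w j i
        = ∑ i, c i * w j i + a * (∑ i, c' i * w j i - ∑ i, c i * w j i) := by
      rw [← Finset.sum_sub_distrib, Finset.mul_sum, ← Finset.sum_add_distrib]
      refine Finset.sum_congr rfl fun i _ => ?_
      simp; ring
    rw [this]
    simp only [Pi.add_apply, Pi.smul_apply, Pi.sub_apply, smul_eq_mul, h, h']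
    ring
  · simp only [Pi.add_apply, Pi.smul_apply, Pi.sub_apply, smul_eq_mul, Finset.sum_add_distrib,
      ← Finset.mul_sum, Finset.sum_sub_distrib, h1, h1']
    ring

theorem cone1_compact : IsCompact (cone1 w) := by
  let Φ : ((Fin k → ℝ) × ℝ) →ₗ[ℝ] (Fin N → ℝ) :=
    { toFun := fun p j => p.2 - ∑ i, p.1 i * w j i
      map_add' := by
        intro p q; ext j
        simp [add_mul, Finset.sum_add_distrib]; ring
      map_smul' := by
        intro a p; ext j
        simp [mul_sub, Finset.mul_sum, mul_assoc] }
  have hV : IsClosed ((LinearMap.range Φ : Submodule ℝ (Fin N → ℝ)) : Set (Fin N → ℝ)) :=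
    Submodule.closed_of_finiteDimensional _
  have hs : IsClosed {f : Fin N → ℝ | ∑ j, f j = 1} :=
    isClosed_eq (by fun_prop) continuous_const
  have : cone1 w = Set.Icc 0 1 ∩ (((LinearMap.range Φ : Submodule ℝ (Fin N → ℝ)) :
      Set (Fin N → ℝ)) ∩ {f : Fin N → ℝ | ∑ j, f j = 1}) := by
    ext f
    constructor
    · rintro ⟨⟨⟨c, α, h⟩, h1⟩, h0⟩
      refine ⟨⟨fun j => h0 j, fun j => ?_⟩, ⟨(c, α), ?_⟩, h1⟩
      · show f j ≤ 1
        rw [← h1]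
        exact Finset.single_le_sum (fun i _ => h0 i) (Finset.mem_univ j)
      · ext j; exact (h j).symm
    · rintro ⟨h0, ⟨⟨c, α⟩, h⟩, h1⟩
      exact ⟨⟨⟨c, α, fun j => by rw [← h]; rfl⟩, h1⟩, fun j => h0.1 j⟩
  rw [this]
  exact isCompact_Icc.inter_right (hV.inter hs)

theorem cone1_mem_of (f : Fin N → ℝ) (c : Fin k → ℝ) (α : ℝ)
    (h : ∀ j, f j = α - ∑ i, c i * w j i) (h0 : ∀ j, 0 ≤ f j) (hs : 0 < ∑ j, f j) :
    (∑ j, f j)⁻¹ • f ∈ cone1 w := by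
  set s := ∑ j, f j with hsd
  refine ⟨⟨⟨s⁻¹ • c, s⁻¹ * α, fun j => ?_⟩, ?_⟩, fun j => ?_⟩
  · simp [h, mul_sub, Finset.mul_sum, mul_assoc]
  · simp only [Pi.smul_apply, smul_eq_mul, ← Finset.mul_sum, ← hsd]
    field_simp
  · exact mul_nonneg (by positivity) (h0 j)

/-- The face of the polytope cut out by a (supporting) affine function. -/
theorem ext_facet (hne : ∃ x ∈ convexHull ℝ (Set.range w), ∃ y ∈ convexHull ℝ (Set.range w), x ≠ y)
    (f : Fin N → ℝ) (hf : f ∈ Set.extremePoints ℝ (cone1 w)) (c : Fin k → ℝ) (α : ℝ)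
    (h : ∀ j, f j = α - ∑ i, c i * w j i) :
    IsFacet (convexHull ℝ (Set.range w)) {y ∈ convexHull ℝ (Set.range w) | ∑ i, c i * y i = α} := by
  have hf0 : ∀ j, 0 ≤ f j := hf.1.2
  have hf1 : ∑ j, f j = 1 := hf.1.1.2
  have hw : ∀ j, w j ∈ convexHull ℝ (Set.range w) := fun j =>
    subset_convexHull ℝ _ (Set.mem_range_self j)
  have uniq : ∀ g ∈ cone1 w, (∀ j, f j = 0 → g j = 0) → g = f := fun g hg hz =>
    ext_unique (affL w) _ (affL_line w) f g hf hg hz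
  have sumpos : ∀ g : Fin N → ℝ, (∀ j, 0 ≤ g j) → ∀ j, g j ≠ 0 → 0 < ∑ j, g j := fun g hg j hj =>
    Finset.sum_pos' (fun i _ => hg i) ⟨j, Finset.mem_univ _, (hg j).lt_of_ne (Ne.symm hj)⟩
  refine ⟨⟨fun y hy => hy.1, c, α, fun y hy => ?_, rfl⟩, ?_, ?_, ?_⟩
  · obtain ⟨μ, hμ0, hμ1, hμ⟩ := hull_weights w y hy
    have e := hull_affine w y μ hμ1 hμ c α
    have : 0 ≤ ∑ j, μ j * (α - ∑ i, c i * w j i) :=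
      Finset.sum_nonneg fun j _ => mul_nonneg (hμ0 j) (by rw [← h]; exact hf0 j)
    linarith
  · -- some zero
    by_contra hemp
    have hpos : ∀ j, f j ≠ 0 := by
      intro j hj
      apply hemp
      exact ⟨w j, hw j, by have := h j; linarith⟩
    obtain ⟨x, hx, y, hy, hxy⟩ := hne
    have hex : ∃ a b, w a ≠ w b := by
      by_contra hall
      push Not at hall
      apply hxy
      obtain ⟨μ, _, hμ1, hμ⟩ := hull_weights w x hx
      obtain ⟨ν, _, hν1, hν⟩ := hull_weights w y hy
      rcases isEmpty_or_nonempty (Fin N) with hN | ⟨⟨j0⟩⟩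
      · simp at hμ1
      ext i
      rw [hμ i, hν i]
      have e : ∀ j, w j i = w j0 i := fun j => by rw [hall j j0]
      simp only [e, ← Finset.sum_mul, hμ1, hν1]
    obtain ⟨a, b, hab⟩ := hex
    obtain ⟨i, hi⟩ := Function.ne_iff.1 hab
    have : Nonempty (Fin N) := ⟨a⟩
    obtain ⟨j0, hj0⟩ := Finite.exists_min (fun j => w j i)
    let g : Fin N → ℝ := fun j => w j i - w j0 i
    have hg0 : ∀ j, 0 ≤ g j := fun j => sub_nonneg.2 (hj0 j)
    have hgs : 0 < ∑ j, g j := by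
      by_cases hga : g a = 0
      · refine sumpos g hg0 b fun hgb => hi ?_
        simp only [g] at hga hgb
        linarith
      · exact sumpos g hg0 a hga
    have hg := cone1_mem_of w g (fun i' => if i' = i then -1 else 0) (- w j0 i)
      (fun j => by simp [g]; ring) hg0 hgs
    have := uniq _ hg (fun j hj => absurd hj (hpos j))
    apply hpos j0
    rw [← this]
    simp [g]
  · intro heq
    have : ∀ j, f j = 0 := by
      intro j
      have hj := hw j
      rw [← heq] at hj
      rw [h, hj.2, sub_self]
    simp [this] at hf1
  · rintro F' ⟨hF'Q, c', α', hle, hF'⟩ hF'ne hF'Qne hsub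
    let g : Fin N → ℝ := fun j => α' - ∑ i, c' i * w j i
    have hg0 : ∀ j, 0 ≤ g j := fun j => sub_nonneg.2 (hle _ (hw j))
    have hgs : 0 < ∑ j, g j := by
      by_contra hn
      have hall : ∀ j, g j = 0 := by
        intro j
        by_contra hj
        exact hn (sumpos g hg0 j hj)
      apply hF'Qne
      refine hF'Q.antisymm fun y hy => ?_
      rw [hF']
      refine ⟨hy, ?_⟩
      obtain ⟨μ, hμ0, hμ1, hμ⟩ := hull_weights w y hy
      have e := hull_affine w y μ hμ1 hμ c' α'
      have : ∑ j, μ j * (α' - ∑ i, c' i * w j i) = 0 :=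
        Finset.sum_eq_zero fun j _ => by
          have := hall j
          simp only [g] at this
          rw [this, mul_zero]
      linarith
    have hg := cone1_mem_of w g c' α' (fun j => rfl) hg0 hgs
    have hu := uniq _ hg (fun j hj => by
      have : w j ∈ F' := hsub ⟨hw j, by have := h j; linarith⟩
      rw [hF'] at this
      simp [g, this.2])
    set s := ∑ j, g j
    have hgf : ∀ j, α' - ∑ i, c' i * w j i = s * (α - ∑ i, c i * w j i) := by
      intro j
      rw [← h, ← hu]
      simp only [Pi.smul_apply, smul_eq_mul, g]
      field_simp
    rw [hF']
    ext y
    refine and_congr_right fun hy => ?_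
    obtain ⟨μ, hμ0, hμ1, hμ⟩ := hull_weights w y hy
    have e := hull_affine w y μ hμ1 hμ c α
    have e' := hull_affine w y μ hμ1 hμ c' α'
    simp only [hgf] at e'
    have e2 : ∑ j, μ j * (s * (α - ∑ i, c i * w j i)) = s * ∑ j, μ j * (α - ∑ i, c i * w j i) := by
      rw [Finset.mul_sum]
      exact Finset.sum_congr rfl fun j _ => by ring
    rw [e2, ← e] at e'
    constructor
    · intro h0
      rw [h0, sub_self] at e'
      rcases mul_eq_zero.1 e'.symm with h3 | h3 <;> linarith
    · intro h0
      rw [h0, sub_self, mul_zero] at e'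
      linarith

theorem facets_finite : {F | IsFacet (convexHull ℝ (Set.range w)) F}.Finite := by
  refine Set.Finite.of_injOn (f := fun F => {j | w j ∈ F}) (t := Set.univ)
    (fun _ _ => Set.mem_univ _) ?_ Set.finite_univ
  have hw : ∀ j, w j ∈ convexHull ℝ (Set.range w) := fun j =>
    subset_convexHull ℝ _ (Set.mem_range_self j)
  have key : ∀ F G, IsExposedFace (convexHull ℝ (Set.range w)) F →
      IsExposedFace (convexHull ℝ (Set.range w)) G → (∀ j, w j ∈ F → w j ∈ G) → F ⊆ G := by
    rintro F G ⟨_, c, α, hle, rfl⟩ ⟨_, c', α', hle', rfl⟩ hFG y ⟨hy, hy0⟩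
    refine ⟨hy, ?_⟩
    obtain ⟨μ, hμ0, hμ1, hμ⟩ := hull_weights w y hy
    have e := hull_affine w y μ hμ1 hμ c α
    have e' := hull_affine w y μ hμ1 hμ c' α'
    rw [hy0, sub_self] at e
    have hz := (Finset.sum_eq_zero_iff_of_nonneg (fun j _ =>
      mul_nonneg (hμ0 j) (sub_nonneg.2 (hle _ (hw j))))).1 e.symm
    have : ∑ j, μ j * (α' - ∑ i, c' i * w j i) = 0 :=
      Finset.sum_eq_zero fun j hj => by
        rcases mul_eq_zero.1 (hz j hj) with h3 | h3
        · rw [h3, zero_mul]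
        · have := (hFG j ⟨hw j, by linarith⟩).2
          rw [this, sub_self, mul_zero]
    linarith
  intro F hF G hG h
  have h' : ∀ j, w j ∈ F ↔ w j ∈ G := fun j => by
    have := congrArg (fun s => j ∈ s) h
    simpa using this
  exact (key F G hF.1 hG.1 fun j => (h' j).1).antisymm (key G F hG.1 hF.1 fun j => (h' j).2)

theorem ext_ncard_le
    (hne : ∃ x ∈ convexHull ℝ (Set.range w), ∃ y ∈ convexHull ℝ (Set.range w), x ≠ y) :
    (Set.extremePoints ℝ (cone1 w)).ncard ≤ polySize (convexHull ℝ (Set.range w)) := by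
  classical
  have hr : ∀ f : Fin N → ℝ, ∃ (c : Fin k → ℝ) (α : ℝ), f ∈ cone1 w →
      ∀ j, f j = α - ∑ i, c i * w j i := by
    intro f
    by_cases hf : f ∈ cone1 w
    · obtain ⟨c, α, h⟩ := hf.1.1
      exact ⟨c, α, fun _ => h⟩
    · exact ⟨0, 0, fun h => absurd h hf⟩
  choose c α h using hr
  refine Set.ncard_le_ncard_of_injOn
    (fun f => {y ∈ convexHull ℝ (Set.range w) | ∑ i, c f i * y i = α f}) ?_ ?_ (facets_finite w)
  · intro f hf
    exact ext_facet w hne f hf _ _ (h f hf.1)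
  · intro f hf g hg hfg
    have hw : ∀ j, w j ∈ convexHull ℝ (Set.range w) := fun j =>
      subset_convexHull ℝ _ (Set.mem_range_self j)
    refine (ext_unique (affL w) _ (affL_line w) f g hf hg.1 fun j hj => ?_).symm
    have hj : f j = 0 := hj
    show g j = 0
    have hm : w j ∈ {y ∈ convexHull ℝ (Set.range w) | ∑ i, c f i * y i = α f} :=
      ⟨hw j, by have := h f hf.1 j; linarith⟩
    simp only at hfg
    rw [hfg] at hm
    rw [h g hg.1 j, hm.2, sub_self]

end facets

theorem mv_apply {m n : ℕ} (M : Matrix (Fin m) (Fin n) ℝ) (x : Fin n → ℝ) (i : Fin m) :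
    M.mulVec x i = ∑ j, M i j * x j := rfl

theorem mv_nonneg {m n : ℕ} (M : Matrix (Fin m) (Fin n) ℝ) (x : Fin n → ℝ) (i : Fin m)
    (h : ∀ j, 0 ≤ M i j) (hx : ∀ j, 0 ≤ x j) : 0 ≤ M.mulVec x i := by
  rw [mv_apply]
  exact Finset.sum_nonneg fun j _ => mul_nonneg (h j) (hx j)

/-- Nonnegative affine functions are nonnegative combinations of extreme ones. -/
theorem aff_comb {N k : ℕ} (w : Fin N → Fin k → ℝ) [Fintype (Set.extremePoints ℝ (cone1 w))]
    (c : Fin k → ℝ) (α : ℝ) (h0 : ∀ j, 0 ≤ α - ∑ i, c i * w j i) :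
    ∃ T : Set.extremePoints ℝ (cone1 w) → ℝ, (∀ f, 0 ≤ T f) ∧
      ∀ j, α - ∑ i, c i * w j i = ∑ f, T f * f.1 j := by
  let g : Fin N → ℝ := fun j => α - ∑ i, c i * w j i
  rcases (Finset.sum_nonneg fun j _ => h0 j : 0 ≤ ∑ j, g j).eq_or_lt with hs | hs
  · refine ⟨0, fun _ => le_rfl, fun j => ?_⟩
    have := (Finset.sum_eq_zero_iff_of_nonneg (fun j _ => h0 j)).1 hs.symm j (Finset.mem_univ j)
    simp [this]
  · have hg := cone1_mem_of w g c α (fun j => rfl) h0 hs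
    have hh : cone1 w = convexHull ℝ (Set.extremePoints ℝ (cone1 w)) :=
      poly_hull (affL w) _ (affL_line w) (cone1_compact w)
    rw [hh, (Set.toFinite (Set.extremePoints ℝ (cone1 w))).convexHull_eq] at hg
    obtain ⟨μ, hμ0, hμ1, hμ⟩ := hg
    set s := ∑ j, g j
    refine ⟨fun f => s * μ f.1, fun f => mul_nonneg hs.le (hμ0 _ f.2), fun j => ?_⟩
    rw [Finset.centerMass_eq_of_sum_1 _ _ hμ1] at hμ
    have hj := congrFun hμ j
    simp only [Finset.sum_apply, Pi.smul_apply, smul_eq_mul, id] at hj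
    have e : α - ∑ i, c i * w j i = s * (s⁻¹ * g j) := by
      simp only [g]; field_simp
    rw [e, ← hj, Finset.mul_sum]
    have hsub := Finset.sum_subtype (F := inferInstanceAs (Fintype (Set.extremePoints ℝ (cone1 w))))
      (Set.toFinite (Set.extremePoints ℝ (cone1 w))).toFinset
      (p := fun f => f ∈ Set.extremePoints ℝ (cone1 w)) (by simp) (fun f => s * (μ f * f j))
    rw [hsub]
    exact Finset.sum_congr (by ext; simp) fun f _ => by ring

theorem ii_to_i {d m n : ℕ}
    (A : Matrix (Fin m) (Fin d) ℝ) (b : Fin m → ℝ)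
    (P : Set (Fin d → ℝ)) (hP : P = {x | A.mulVec x ≤ b})
    (v : Fin n → (Fin d → ℝ)) (hconv : P = convexHull ℝ (Set.range v))
    (hdim : ∃ x ∈ P, ∃ y ∈ P, x ≠ y)
    (S : Matrix (Fin m) (Fin n) ℝ)
    (hS : ∀ i j, S i j = b i - A.mulVec (v j) i)
    (k : ℕ) (Q : Set (Fin k → ℝ)) (hQ : IsExtension P Q) : nrank S ≤ polySize Q := by
  obtain ⟨⟨W, hW, rfl⟩, π, hπ⟩ := hQ
  obtain ⟨N, w, rfl⟩ := hW.fin_embedding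
  have hne : ∃ x ∈ convexHull ℝ (Set.range w), ∃ y ∈ convexHull ℝ (Set.range w), x ≠ y := by
    obtain ⟨x, hx, y, hy, hxy⟩ := hdim
    rw [← hπ] at hx hy
    obtain ⟨x', hx', rfl⟩ := hx
    obtain ⟨y', hy', rfl⟩ := hy
    exact ⟨x', hx', y', hy', fun h => hxy (by rw [h])⟩
  refine le_trans ?_ (ext_ncard_le w hne)
  have hfin : (Set.extremePoints ℝ (cone1 w)).Finite := ext_finite (affL w) _ (affL_line w)
  let _ : Fintype (Set.extremePoints ℝ (cone1 w)) := hfin.fintype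
  rw [← Nat.card_coe_set_eq, Nat.card_eq_fintype_card]
  have hpre : ∀ j, ∃ μ : Fin N → ℝ, ∃ y : Fin k → ℝ, π y = v j ∧ (∀ l, 0 ≤ μ l) ∧ ∑ l, μ l = 1 ∧
      ∀ i, y i = ∑ l, μ l * w l i := by
    intro j
    have : v j ∈ P := by rw [hconv]; exact subset_convexHull ℝ _ (Set.mem_range_self j)
    rw [← hπ] at this
    obtain ⟨y, hy, hyv⟩ := this
    obtain ⟨μ, h⟩ := hull_weights w y hy
    exact ⟨μ, y, hyv, h⟩
  choose μ y hy hμ0 hμ1 hμ using hpre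
  have hlin : ∀ i : Fin m, ∃ c : Fin k → ℝ, ∀ z, A.mulVec (π z) i = ∑ l, c l * z l := by
    intro i
    let φ : (Fin k → ℝ) →ₗ[ℝ] ℝ := (LinearMap.proj i) ∘ₗ A.mulVecLin ∘ₗ π
    refine ⟨fun l => φ (Pi.single l 1), fun z => ?_⟩
    have := LinearMap.pi_apply_eq_sum_univ φ z
    change φ z = _
    rw [this]
    refine Finset.sum_congr rfl fun l _ => ?_
    rw [smul_eq_mul, mul_comm]
    congr 2
    ext l'
    simp [Pi.single_apply, eq_comm]
  choose c hc using hlin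
  have hT : ∀ i, ∃ T : Set.extremePoints ℝ (cone1 w) → ℝ, (∀ f, 0 ≤ T f) ∧
      ∀ j, b i - ∑ l, c i l * w j l = ∑ f, T f * f.1 j := by
    intro i
    refine aff_comb w (c i) (b i) fun j => ?_
    rw [← hc]
    have : π (w j) ∈ P := by
      rw [← hπ]
      exact ⟨w j, subset_convexHull ℝ _ (Set.mem_range_self j), rfl⟩
    rw [hP] at this
    exact sub_nonneg.2 (this i)
  choose T hT0 hT using hT
  refine nrank_le_card S T (fun f j => ∑ l, μ j l * f.1 l) hT0
    (fun f j => Finset.sum_nonneg fun l _ => mul_nonneg (hμ0 j l) (f.2.1.2 l)) fun i j => ?_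
  rw [hS, ← hy j, hc, hull_affine w (y j) (μ j) (hμ1 j) (hμ j)]
  simp only [hT, Finset.mul_sum]
  rw [Finset.sum_comm]
  exact Finset.sum_congr rfl fun f _ => Finset.sum_congr rfl fun l _ => by ring

theorem i_to_iii_aux {d m n q : ℕ}
    (A : Matrix (Fin m) (Fin d) ℝ) (b : Fin m → ℝ)
    (P : Set (Fin d → ℝ))
    (v : Fin n → (Fin d → ℝ)) (hconv : P = convexHull ℝ (Set.range v))
    (S : Matrix (Fin m) (Fin n) ℝ)
    (hS : ∀ i j, S i j = b i - A.mulVec (v j) i)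
    (T : Matrix (Fin m) (Fin q) ℝ) (U : Matrix (Fin q) (Fin n) ℝ)
    (hU : ∀ i j, 0 ≤ U i j) (hSTU : S = T * U) (x : Fin d → ℝ) (hx : x ∈ P) :
    ∃ μ : Fin n → ℝ, (∀ j, 0 ≤ μ j) ∧ A.mulVec x + T.mulVec (U.mulVec μ) = b := by
  rw [hconv] at hx
  obtain ⟨μ, hμ0, hμ1, hμ⟩ := hull_weights v x hx
  refine ⟨μ, hμ0, ?_⟩
  ext i
  have e := hull_affine v x μ hμ1 hμ (A i) (b i)
  rw [Matrix.mulVec_mulVec, ← hSTU, Pi.add_apply]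
  have e1 : A.mulVec x i = ∑ l, A i l * x l := rfl
  have e2 : S.mulVec μ i = ∑ j, μ j * (b i - ∑ l, A i l * v j l) := by
    rw [mv_apply]
    refine Finset.sum_congr rfl fun j _ => ?_
    rw [hS, mul_comm, mv_apply]
  rw [e1, e2]
  linarith

theorem i_to_iii {d m n q : ℕ}
    (A : Matrix (Fin m) (Fin d) ℝ) (b : Fin m → ℝ)
    (P : Set (Fin d → ℝ)) (hP : P = {x | A.mulVec x ≤ b})
    (v : Fin n → (Fin d → ℝ)) (hconv : P = convexHull ℝ (Set.range v))
    (S : Matrix (Fin m) (Fin n) ℝ)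
    (hS : ∀ i j, S i j = b i - A.mulVec (v j) i)
    (T : Matrix (Fin m) (Fin q) ℝ) (U : Matrix (Fin q) (Fin n) ℝ) (hT : ∀ i j, 0 ≤ T i j)
    (hU : ∀ i j, 0 ≤ U i j) (hSTU : S = T * U) :
    P = {x | ∃ t : Fin q → ℝ, A.mulVec x + T.mulVec t = b ∧ 0 ≤ t} := by
  ext x
  constructor
  · intro hx
    obtain ⟨μ, hμ0, h⟩ := i_to_iii_aux A b P v hconv S hS T U hU hSTU x hx
    exact ⟨_, h, fun k => mv_nonneg _ _ _ (hU k) hμ0⟩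
  · rintro ⟨t, ht, ht0⟩
    rw [hP]
    intro i
    have := congrFun ht i
    have h2 : 0 ≤ T.mulVec t i := mv_nonneg _ _ _ (hT i) ht0
    simp only [Pi.add_apply] at this
    linarith

theorem iii_to_i {d m n p q : ℕ}
    (A : Matrix (Fin m) (Fin d) ℝ) (b : Fin m → ℝ)
    (P : Set (Fin d → ℝ)) (hP : P = {x | A.mulVec x ≤ b})
    (v : Fin n → (Fin d → ℝ)) (hconv : P = convexHull ℝ (Set.range v))
    (hdim : ∃ x ∈ P, ∃ y ∈ P, x ≠ y)
    (S : Matrix (Fin m) (Fin n) ℝ)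
    (hS : ∀ i j, S i j = b i - A.mulVec (v j) i)
    (E : Matrix (Fin p) (Fin d) ℝ) (F : Matrix (Fin p) (Fin q) ℝ) (g : Fin p → ℝ)
    (hEF : P = {x | ∃ t : Fin q → ℝ, E.mulVec x + F.mulVec t = g ∧ 0 ≤ t}) : nrank S ≤ q := by
  -- the homogenized system
  have hbd : Bornology.IsBounded P := by
    rw [hconv]
    exact ((Set.finite_range v).isCompact_convexHull ℝ).isBounded
  obtain ⟨R, hR⟩ := hbd.exists_norm_le
  -- recession directions vanish
  have hrec : ∀ x ∈ P, ∀ (y : Fin d → ℝ), (∀ a : ℝ, 0 ≤ a → x + a • y ∈ P) → y = 0 := by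
    intro x hx y hy
    by_contra hne
    have hpos : 0 < ‖y‖ := norm_pos_iff.2 hne
    have h1 := hR _ (hy ((2 * |R| + 1) / ‖y‖) (by positivity))
    have h2 := hR x hx
    have h3 : ‖((2 * |R| + 1) / ‖y‖) • y‖ = 2 * |R| + 1 := by
      rw [norm_smul, Real.norm_of_nonneg (by positivity)]
      field_simp
    have h4 : ‖((2 * |R| + 1) / ‖y‖) • y‖ ≤ ‖x + ((2 * |R| + 1) / ‖y‖) • y‖ + ‖x‖ := by
      have := norm_sub_le (x + ((2 * |R| + 1) / ‖y‖) • y) x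
      simpa using this
    have := le_abs_self R
    linarith
  have hrec' : ∀ (y : Fin d → ℝ) (t : Fin q → ℝ), E.mulVec y + F.mulVec t = 0 → 0 ≤ t → y = 0 := by
    intro y t h0 ht
    obtain ⟨x, hx, _⟩ := hdim
    refine hrec x hx y fun a ha => ?_
    rw [hEF] at hx ⊢
    obtain ⟨t0, h1, h2⟩ := hx
    refine ⟨t0 + a • t, ?_, add_nonneg h2 (smul_nonneg ha ht)⟩
    rw [Matrix.mulVec_add, Matrix.mulVec_add, Matrix.mulVec_smul, Matrix.mulVec_smul]
    calc _ = (E.mulVec x + F.mulVec t0) + a • (E.mulVec y + F.mulVec t) := by module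
      _ = g := by rw [h1, h0]; simp
  let M : ((Fin d → ℝ) × (Fin q → ℝ) × ℝ) →ₗ[ℝ] (Fin p → ℝ) :=
    { toFun := fun z => E.mulVec z.1 + F.mulVec z.2.1 - z.2.2 • g
      map_add' := by
        intro z z'
        simp only [Prod.fst_add, Prod.snd_add, Matrix.mulVec_add]
        module
      map_smul' := by
        intro a z
        simp only [Prod.smul_fst, Prod.smul_snd, Matrix.mulVec_smul, RingHom.id_apply, smul_eq_mul]
        module }
  have hM : ∀ x t s, (x, t, s) ∈ LinearMap.ker M → E.mulVec x + F.mulVec t = s • g := by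
    intro x t s h
    exact sub_eq_zero.1 (LinearMap.mem_ker.1 h)
  let ψ : Fin q → (LinearMap.ker M) →ₗ[ℝ] ℝ := fun k =>
    (LinearMap.proj k) ∘ₗ (LinearMap.fst ℝ _ _) ∘ₗ (LinearMap.snd ℝ _ _) ∘ₗ (LinearMap.ker M).subtype
  let φ : Fin m → (LinearMap.ker M) →ₗ[ℝ] ℝ := fun i =>
    (b i • ((LinearMap.snd ℝ _ _) ∘ₗ (LinearMap.snd ℝ _ _)) -
      (LinearMap.proj i) ∘ₗ A.mulVecLin ∘ₗ (LinearMap.fst ℝ _ _)) ∘ₗ (LinearMap.ker M).subtype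
  have hfk : ∀ i, ∃ c : Fin q → ℝ, (∀ k, 0 ≤ c k) ∧ ∀ z, φ i z = ∑ k, c k * ψ k z := by
    intro i
    refine farkas q ψ (φ i) ?_
    rintro ⟨⟨x, t, s⟩, hz⟩ ht
    have ht : 0 ≤ t := ht
    have hz := hM x t s hz
    show 0 ≤ b i * s - A.mulVec x i
    rcases lt_trichotomy s 0 with hs | hs | hs
    · exfalso
      obtain ⟨x0, hx0, x1, hx1, hne⟩ := hdim
      have hzero : ∀ y ∈ P, x + (-s) • y = 0 := by
        intro y hy
        rw [hEF] at hy
        obtain ⟨t0, h1, h2⟩ := hy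
        refine hrec' _ (t + (-s) • t0) ?_ (add_nonneg ht (smul_nonneg (by linarith) h2))
        rw [Matrix.mulVec_add, Matrix.mulVec_add, Matrix.mulVec_smul, Matrix.mulVec_smul]
        calc _ = (E.mulVec x + F.mulVec t) + (-s) • (E.mulVec y + F.mulVec t0) := by module
          _ = 0 := by rw [hz, h1]; module
      have h3 := (hzero x0 hx0).trans (hzero x1 hx1).symm
      have h4 := add_left_cancel h3
      exact hne (smul_right_injective _ (by linarith : (-s) ≠ 0) h4)
    · subst hs
      have := hrec' x t (by rw [hz, zero_smul]) ht
      subst this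
      simp
    · have hin : s⁻¹ • x ∈ P := by
        rw [hEF]
        refine ⟨s⁻¹ • t, ?_, smul_nonneg (by positivity) ht⟩
        rw [Matrix.mulVec_smul, Matrix.mulVec_smul, ← smul_add, hz, smul_smul,
          inv_mul_cancel₀ hs.ne', one_smul]
      rw [hP] at hin
      have := hin i
      rw [Matrix.mulVec_smul, Pi.smul_apply, smul_eq_mul, inv_mul_le_iff₀ hs] at this
      linarith
  choose c hc0 hc using hfk
  have hv : ∀ j, ∃ t : Fin q → ℝ, E.mulVec (v j) + F.mulVec t = g ∧ 0 ≤ t := by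
    intro j
    have : v j ∈ P := by rw [hconv]; exact subset_convexHull ℝ _ (Set.mem_range_self j)
    rw [hEF] at this
    exact this
  choose t ht ht0 using hv
  have := nrank_le_card S c (fun k j => t j k) hc0 (fun k j => ht0 j k) (fun i j => by
    have hk : (v j, t j, (1:ℝ)) ∈ LinearMap.ker M := by
      rw [LinearMap.mem_ker]
      show E.mulVec (v j) + F.mulVec (t j) - (1:ℝ) • g = 0
      rw [ht, one_smul, sub_self]
    have h1 := hc i ⟨_, hk⟩
    have h2 : φ i ⟨_, hk⟩ = b i * 1 - A.mulVec (v j) i := rfl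
    rw [hS, ← mul_one (b i), ← h2, h1]
    rfl)
  simpa using this

theorem i_to_ii {d m n q : ℕ}
    (A : Matrix (Fin m) (Fin d) ℝ) (b : Fin m → ℝ)
    (P : Set (Fin d → ℝ)) (hP : P = {x | A.mulVec x ≤ b})
    (v : Fin n → (Fin d → ℝ)) (hconv : P = convexHull ℝ (Set.range v))
    (S : Matrix (Fin m) (Fin n) ℝ)
    (hS : ∀ i j, S i j = b i - A.mulVec (v j) i)
    (T : Matrix (Fin m) (Fin q) ℝ) (U : Matrix (Fin q) (Fin n) ℝ) (hT : ∀ i j, 0 ≤ T i j)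
    (hU : ∀ i j, 0 ≤ U i j) (hSTU : S = T * U) :
    ∃ (k : ℕ) (Q : Set (Fin k → ℝ)), IsExtension P Q ∧ polySize Q ≤ q := by
  classical
  have hbd : Bornology.IsBounded P := by
    rw [hconv]
    exact ((Set.finite_range v).isCompact_convexHull ℝ).isBounded
  obtain ⟨R, hR⟩ := hbd.exists_norm_le
  let X : (Fin (d + q) → ℝ) →ₗ[ℝ] (Fin d → ℝ) := LinearMap.funLeft ℝ ℝ (Fin.castAdd q)
  let Y : (Fin (d + q) → ℝ) →ₗ[ℝ] (Fin q → ℝ) := LinearMap.funLeft ℝ ℝ (Fin.natAdd d)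
  let L : Set (Fin (d + q) → ℝ) := {y | A.mulVec (X y) + T.mulVec (Y y) = b ∧
    ∀ k, (∀ i, T i k = 0) → Y y k = 0}
  have hL : ∀ z ∈ L, ∀ z' ∈ L, ∀ a : ℝ, z + a • (z' - z) ∈ L := by
    rintro z ⟨h1, h2⟩ z' ⟨h1', h2'⟩ a
    refine ⟨?_, fun k hk => ?_⟩
    · simp only [map_add, map_smul, map_sub, Matrix.mulVec_add, Matrix.mulVec_smul,
        Matrix.mulVec_sub]
      calc _ = (A.mulVec (X z) + T.mulVec (Y z)) + a • ((A.mulVec (X z') + T.mulVec (Y z')) -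
            (A.mulVec (X z) + T.mulVec (Y z))) := by module
        _ = b := by rw [h1, h1']; simp
    · simp [h2 k hk, h2' k hk]
  let Q : Set (Fin (d + q) → ℝ) := {y | y ∈ L ∧ ∀ k : Fin q, 0 ≤ y (Fin.natAdd d k)}
  have hXP : ∀ y ∈ Q, X y ∈ P := by
    rintro y ⟨⟨h1, _⟩, h0⟩
    rw [i_to_iii A b P hP v hconv S hS T U hT hU hSTU]
    exact ⟨Y y, h1, fun k => h0 k⟩
  have hLc : IsClosed L := by
    have hXc : Continuous X := LinearMap.continuous_of_finiteDimensional X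
    have hYc : Continuous Y := LinearMap.continuous_of_finiteDimensional Y
    refine IsClosed.inter (isClosed_eq ?_ continuous_const) ?_
    · exact (Continuous.matrix_mulVec continuous_const hXc).add
        (Continuous.matrix_mulVec continuous_const hYc)
    · have : {y : Fin (d + q) → ℝ | ∀ k, (∀ i, T i k = 0) → Y y k = 0}
          = ⋂ k, ⋂ (_ : ∀ i, T i k = 0), {y | Y y k = 0} := by
        ext y; simp
      change IsClosed {y : Fin (d + q) → ℝ | ∀ k, (∀ i, T i k = 0) → Y y k = 0}
      rw [this]
      exact isClosed_iInter fun k => isClosed_iInter fun _ =>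
        isClosed_eq ((continuous_apply k).comp hYc) continuous_const
  have hQc : IsClosed Q := by
    refine hLc.inter ?_
    have : {y : Fin (d + q) → ℝ | ∀ k : Fin q, 0 ≤ y (Fin.natAdd d k)}
        = ⋂ k : Fin q, {y | 0 ≤ y (Fin.natAdd d k)} := by
      ext y; simp
    change IsClosed {y : Fin (d + q) → ℝ | ∀ k : Fin q, 0 ≤ y (Fin.natAdd d k)}
    rw [this]
    exact isClosed_iInter fun k => isClosed_le continuous_const (continuous_apply _)
  have hbound : ∀ l : Fin (d + q), ∃ B : ℝ, ∀ y ∈ Q, |y l| ≤ B := by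
    intro l
    refine Fin.addCases (fun i => ?_) (fun k => ?_) l
    · exact ⟨R, fun y hy => (norm_le_pi_norm (X y) i).trans (hR _ (hXP y hy))⟩
    · by_cases hk : ∀ i, T i k = 0
      · refine ⟨0, fun y hy => ?_⟩
        have : y (Fin.natAdd d k) = 0 := hy.1.2 k hk
        rw [this, abs_zero]
      · push Not at hk
        obtain ⟨i, hi⟩ := hk
        have hpos : 0 < T i k := (hT i k).lt_of_ne (Ne.symm hi)
        refine ⟨(|b i| + ∑ l, |A i l| * R) / T i k, fun y hy => ?_⟩
        rw [abs_of_nonneg (hy.2 k), le_div_iff₀ hpos]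
        have h1 := congrFun hy.1.1 i
        have h2 : T i k * y (Fin.natAdd d k) ≤ T.mulVec (Y y) i :=
          Finset.single_le_sum (f := fun k' => T i k' * Y y k')
            (fun k' _ => mul_nonneg (hT i k') (hy.2 k')) (Finset.mem_univ k)
        have h3 : |A.mulVec (X y) i| ≤ ∑ l, |A i l| * R := by
          rw [mv_apply]
          refine (Finset.abs_sum_le_sum_abs _ _).trans (Finset.sum_le_sum fun l _ => ?_)
          rw [abs_mul]
          exact mul_le_mul_of_nonneg_left
            ((norm_le_pi_norm (X y) l).trans (hR _ (hXP y hy))) (abs_nonneg _)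
        have h4 := neg_abs_le (A.mulVec (X y) i)
        have h5 := le_abs_self (b i)
        simp only [Pi.add_apply] at h1
        linarith
  choose B hB using hbound
  have hQcomp : IsCompact Q := by
    refine IsCompact.of_isClosed_subset (isCompact_Icc (a := -B) (b := B)) hQc fun y hy => ?_
    exact ⟨fun l => (abs_le.1 (hB l y hy)).1, fun l => (abs_le.1 (hB l y hy)).2⟩
  let ℓ : Fin q → (Fin (d + q) → ℝ) →ₗ[ℝ] ℝ := fun k => LinearMap.proj (Fin.natAdd d k)
  refine ⟨d + q, Q, ⟨⟨_, ext_finite L ℓ hL, poly_hull L ℓ hL hQcomp⟩, X, ?_⟩, ?_⟩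
  · ext x
    constructor
    · rintro ⟨y, hy, rfl⟩
      exact hXP y hy
    · intro hx
      let U' : Matrix (Fin q) (Fin n) ℝ :=
        Matrix.of fun k j => if ∀ i, T i k = 0 then 0 else U k j
      have hU' : ∀ k j, 0 ≤ U' k j := by
        intro k j
        simp only [U', Matrix.of_apply]
        split_ifs
        · exact le_rfl
        · exact hU k j
      have hSTU' : S = T * U' := by
        rw [hSTU]
        ext i j
        rw [Matrix.mul_apply, Matrix.mul_apply]
        refine Finset.sum_congr rfl fun k _ => ?_
        simp only [U', Matrix.of_apply]
        split_ifs with hk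
        · simp [hk i]
        · rfl
      obtain ⟨μ, hμ0, h⟩ := i_to_iii_aux A b P v hconv S hS T U' hU' hSTU' x hx
      have hX : X (Fin.append x (U'.mulVec μ)) = x := by
        ext i; simp [X, LinearMap.funLeft_apply]
      have hY : Y (Fin.append x (U'.mulVec μ)) = U'.mulVec μ := by
        ext i; simp [Y, LinearMap.funLeft_apply]
      refine ⟨Fin.append x (U'.mulVec μ), ⟨⟨by rw [hX, hY, h], fun k hk => ?_⟩, fun k => ?_⟩, hX⟩
      · rw [hY, mv_apply]
        refine Finset.sum_eq_zero fun j _ => ?_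
        simp [U', hk]
      · rw [Fin.append_right]
        exact mv_nonneg _ _ _ (hU' k) hμ0
  · simpa using facets_le L (fun k : Fin q => Fin.natAdd d k) hL

end Yann

/-- Yannakakis factorization theorem: for a polytope
`P = {x : A x ≤ b} = conv {v₁, …, vₙ}` of dimension at least one, with slack matrix
`S i j = b i - Aᵢᵀ vⱼ`, and any positive integer `r`: `nrank S ≤ r` iff `P` has an
extension of size at most `r`, iff `P` has an extended formulation in slack form
`P = {x : ∃ t ∈ ℝ^q, E x + F t = g, t ≥ 0}` with `q ≤ r`.  In particular
`xc P = nrank S`. -/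
theorem yannakakis_factorization {d m n : ℕ}
    (A : Matrix (Fin m) (Fin d) ℝ) (b : Fin m → ℝ)
    (P : Set (Fin d → ℝ)) (hP : P = {x | A.mulVec x ≤ b})
    (v : Fin n → (Fin d → ℝ)) (hconv : P = convexHull ℝ (Set.range v))
    (hdim : ∃ x ∈ P, ∃ y ∈ P, x ≠ y)
    (S : Matrix (Fin m) (Fin n) ℝ)
    (hS : ∀ i j, S i j = b i - A.mulVec (v j) i)
    (r : ℕ) (hr : 0 < r) :
    ((nrank S ≤ r ↔
        ∃ (k : ℕ) (Q : Set (Fin k → ℝ)), IsExtension P Q ∧ polySize Q ≤ r) ∧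
      (nrank S ≤ r ↔
        ∃ (p q : ℕ) (E : Matrix (Fin p) (Fin d) ℝ) (F : Matrix (Fin p) (Fin q) ℝ)
          (g : Fin p → ℝ), q ≤ r ∧
          P = {x | ∃ t : Fin q → ℝ, E.mulVec x + F.mulVec t = g ∧ 0 ≤ t})) ∧
    xc P = nrank S := by
  have hS0 : ∀ i j, 0 ≤ S i j := by
    intro i j
    have : v j ∈ P := by rw [hconv]; exact subset_convexHull ℝ _ (Set.mem_range_self j)
    rw [hP] at this
    rw [hS]
    exact sub_nonneg.2 (this i)
  obtain ⟨T, U, hT, hU, hSTU⟩ := Yann.nrank_spec S hS0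
  have h12 := Yann.i_to_ii A b P hP v hconv S hS T U hT hU hSTU
  have h21 := Yann.ii_to_i A b P hP v hconv hdim S hS
  refine ⟨⟨⟨fun h => ?_, ?_⟩, ⟨fun h => ?_, ?_⟩⟩, le_antisymm ?_ ?_⟩
  · obtain ⟨k, Q, hQ, hs⟩ := h12
    exact ⟨k, Q, hQ, hs.trans h⟩
  · rintro ⟨k, Q, hQ, hs⟩
    exact (h21 k Q hQ).trans hs
  · exact ⟨m, nrank S, A, T, b, h, Yann.i_to_iii A b P hP v hconv S hS T U hT hU hSTU⟩
  · rintro ⟨p, q, E, F, g, hq, hEF⟩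
    exact (Yann.iii_to_i A b P hP v hconv hdim S hS E F g hEF).trans hq
  · obtain ⟨k, Q, hQ, hs⟩ := h12
    exact le_trans (Nat.sInf_le ⟨k, Q, hQ, rfl⟩) hs
  · obtain ⟨k, Q, hQ, _⟩ := h12
    have hmem := Nat.sInf_mem (s := {r : ℕ | ∃ (k : ℕ) (Q : Set (Fin k → ℝ)),
      IsExtension P Q ∧ polySize Q = r}) ⟨_, k, Q, hQ, rfl⟩
    obtain ⟨k', Q', hQ', hs'⟩ := hmem
    have := h21 k' Q' hQ'
    rw [hs'] at this
    exact this
end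

section
/- Let G = (V,E) be a perfect graph and let 𝒞 be the set of maximal cliques of G. Then xc(STAB(G)) ≤ |V| + |𝒞|. -/
/-- The stable set polytope of a graph: the convex hull of the characteristic vectors of
its independent (stable) sets. -/
def stab {V : Type*} [Fintype V] (G : SimpleGraph V) : Set (V → ℝ) :=
  convexHull ℝ {x : V → ℝ |
    ∃ S : Set V, (∀ u ∈ S, ∀ v ∈ S, ¬ G.Adj u v) ∧ x = S.indicator 1}

/-- The clique number of a graph. -/
noncomputable def cliqueNum {V : Type*} (G : SimpleGraph V) : ℕ :=
  sSup {n : ℕ | ∃ s : Finset V, G.IsNClique n s}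

/-- A graph is perfect if every induced subgraph has chromatic number equal to its
clique number. -/
def IsPerfect {V : Type*} (G : SimpleGraph V) : Prop :=
  ∀ S : Set V, (G.induce S).chromaticNumber = (cliqueNum (G.induce S) : ℕ∞)

/-- A maximal clique of a graph: a clique not strictly contained in another clique. -/
def IsMaxClique {V : Type*} (G : SimpleGraph V) (s : Finset V) : Prop :=
  G.IsClique ↑s ∧ ∀ t : Finset V, G.IsClique ↑t → s ⊆ t → s = t

open Classical in
/-- Weighted colouring of perfect graphs (the replication lemma in weighted form). -/
theorem perfect_weighted {V : Type*} [Fintype V] (G : SimpleGraph V) (hG : IsPerfect G) :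
    ∀ (m : ℕ) (w : V → ℕ) (n : ℕ), ∑ v, w v = m →
      (∀ K : Finset V, G.IsClique ↑K → ∑ v ∈ K, w v ≤ n) →
      ∃ c : Fin n → Finset V, (∀ i, ∀ u ∈ c i, ∀ v ∈ c i, ¬ G.Adj u v) ∧
        ∀ v, ∑ i, (if v ∈ c i then 1 else 0) = w v := by
  intro m
  induction m using Nat.strong_induction_on with
  | _ m ih =>
  intro w n hm hK
  by_cases h1 : ∀ v, w v ≤ 1
  · -- base case
    have hcol : (G.induce {v | w v = 1}).Colorable n := by
      rw [← SimpleGraph.chromaticNumber_le_iff_colorable, hG]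
      norm_cast
      apply csSup_le
      · exact ⟨0, ∅, by simp [SimpleGraph.isNClique_iff]⟩
      · rintro k ⟨s, hs⟩
        rw [SimpleGraph.isNClique_iff] at hs
        have := hK (s.map (Function.Embedding.subtype _)) (by
          intro a ha b hb hab
          simp only [Finset.coe_map, Set.mem_image] at ha hb
          obtain ⟨a', ha', rfl⟩ := ha
          obtain ⟨b', hb', rfl⟩ := hb
          exact hs.1 ha' hb' (fun h => hab (by rw [h])))
        rw [Finset.sum_map] at this
        have h2 : ∑ x ∈ s, w ((Function.Embedding.subtype _) x) = ∑ x ∈ s, 1 :=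
          Finset.sum_congr rfl (fun x _ => x.2)
        rw [h2] at this
        simp at this
        omega
    obtain ⟨C⟩ := hcol
    refine ⟨fun i => Finset.univ.filter (fun v => ∃ h : w v = 1, C ⟨v, h⟩ = i), ?_, ?_⟩
    · intro i u hu v hv hadj
      simp only [Finset.mem_filter, Finset.mem_univ, true_and] at hu hv
      obtain ⟨hu, hu'⟩ := hu
      obtain ⟨hv, hv'⟩ := hv
      exact C.valid (v := ⟨u, hu⟩) (w := ⟨v, hv⟩) (by simpa using hadj) (hu'.trans hv'.symm)
    · intro v
      by_cases h : w v = 1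
      · simp [h]
      · have := h1 v
        have h0 : w v = 0 := by omega
        simp [h0]
  · push Not at h1
    obtain ⟨v, hv⟩ := h1
    -- lower the weight of v by one
    let w1 : V → ℕ := fun u => w u - if u = v then 1 else 0
    have hw1 : ∀ u, w1 u + (if u = v then 1 else 0) = w u := by
      intro u
      by_cases h : u = v
      · subst h; simp [w1]; omega
      · simp [w1, h]
    have hw1s : ∀ K : Finset V, ∑ u ∈ K, w1 u + (if v ∈ K then 1 else 0) = ∑ u ∈ K, w u := by
      intro K
      rw [← Finset.sum_congr rfl (fun u _ => hw1 u), Finset.sum_add_distrib]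
      simp
    have hs := hw1s Finset.univ
    simp only [Finset.mem_univ, if_true] at hs
    obtain ⟨c, hc, hcw⟩ := ih (∑ u, w1 u) (by omega) w1 n rfl
      (fun K hKc => by have := hK K hKc; have := hw1s K; omega)
    have hv1 : w1 v ≠ 0 := by have := hw1 v; simp at this; omega
    obtain ⟨i0, hi0⟩ : ∃ i, v ∈ c i := by
      by_contra hcon
      push Not at hcon
      have := hcw v
      simp [hcon] at this
      omega
    obtain ⟨k, rfl⟩ : ∃ k, n = k + 1 := ⟨n - 1, by have := i0.2; omega⟩
    let w2 : V → ℕ := fun u => w u - if u ∈ c i0 then 1 else 0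
    have hw2 : ∀ u, w2 u + (if u ∈ c i0 then 1 else 0) = w u := by
      intro u
      by_cases h : u ∈ c i0
      · have h3 : 1 ≤ w1 u := by
          rw [← hcw u]
          have := Finset.single_le_sum (f := fun i => if u ∈ c i then 1 else 0)
            (fun i _ => Nat.zero_le _) (Finset.mem_univ i0)
          simpa [h] using this
        have := hw1 u
        simp only [w2, h, if_true]
        omega
      · simp [w2, h]
    have hw2s : ∀ K : Finset V, ∑ u ∈ K, w2 u + (K ∩ c i0).card = ∑ u ∈ K, w u := by
      intro K
      rw [← Finset.sum_congr rfl (fun u _ => hw2 u), Finset.sum_add_distrib]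
      simp [Finset.filter_mem_eq_inter]
    have hs2 := hw2s Finset.univ
    have hpos : 0 < (Finset.univ ∩ c i0).card := Finset.card_pos.2 ⟨v, by simp [hi0]⟩
    obtain ⟨d, hd, hdw⟩ := ih (∑ u, w2 u) (by omega) w2 k rfl (by
      intro K hKc
      have a1 := hK K hKc
      have a2 := hw1s K
      have a3 := hw2s K
      by_cases hvK : v ∈ K
      · have : 0 < (K ∩ c i0).card := Finset.card_pos.2 ⟨v, by simp [hi0, hvK]⟩
        omega
      · simp only [hvK, if_false] at a2
        by_cases hint : (K ∩ c i0).card = 0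
        · have hle : ∀ i, (K ∩ c i).card ≤ if i = i0 then 0 else 1 := by
            intro i
            by_cases hi : i = i0
            · subst hi; simp [hint]
            · simp only [hi, if_false]
              rw [Finset.card_le_one]
              intro a ha b hb
              simp only [Finset.mem_inter] at ha hb
              by_contra hab
              exact hc i a ha.2 b hb.2 (hKc ha.1 hb.1 hab)
          have hsum : ∑ u ∈ K, w1 u = ∑ i, (K ∩ c i).card := by
            rw [Finset.sum_congr rfl (fun u _ => (hcw u).symm), Finset.sum_comm]
            simp [Finset.filter_mem_eq_inter]
          have h5 : ∑ i, (K ∩ c i).card ≤ ∑ i : Fin (k+1), if i = i0 then 0 else 1 :=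
            Finset.sum_le_sum (fun i _ => hle i)
          have h6 : ∑ i : Fin (k+1), (if i = i0 then 0 else 1) +
              ∑ i : Fin (k+1), (if i = i0 then 1 else 0) = k + 1 := by
            rw [← Finset.sum_add_distrib, Finset.sum_congr rfl (g := fun _ => 1)]
            · simp
            · intro i _; split_ifs <;> rfl
          rw [Finset.sum_ite_eq' Finset.univ i0 (fun _ => 1)] at h6
          simp only [Finset.mem_univ, if_true] at h6
          omega
        · omega)
    refine ⟨Fin.cons (c i0) d, ?_, ?_⟩
    · intro i
      refine Fin.cases ?_ ?_ i
      · simpa using hc i0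
      · intro j; simpa using hd j
    · intro u
      rw [Fin.sum_univ_succ]
      simp only [Fin.cons_zero, Fin.cons_succ]
      rw [hdw u, add_comm]
      exact hw2 u

/-- Finiteness of the generating set of `stab`. -/
theorem stab_gen_finite {V : Type*} [Fintype V] (G : SimpleGraph V) :
    {x : V → ℝ | ∃ S : Set V, (∀ u ∈ S, ∀ v ∈ S, ¬ G.Adj u v) ∧ x = S.indicator 1}.Finite := by
  apply (Set.finite_range (fun S : Set V => (S.indicator 1 : V → ℝ))).subset
  rintro x ⟨S, _, rfl⟩
  exact ⟨S, rfl⟩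

open Classical in
theorem clique_ineq_of_stab {V : Type*} [Fintype V] (G : SimpleGraph V) {x : V → ℝ}
    (hx : x ∈ stab G) :
    (∀ v, 0 ≤ x v) ∧ ∀ K : Finset V, G.IsClique ↑K → ∑ v ∈ K, x v ≤ 1 := by
  have hconv : Convex ℝ {x : V → ℝ | (∀ v, 0 ≤ x v) ∧
      ∀ K : Finset V, G.IsClique ↑K → ∑ v ∈ K, x v ≤ 1} := by
    rintro x ⟨hx0, hx⟩ y ⟨hy0, hy⟩ a b ha hb hab
    refine ⟨fun v => ?_, fun K hK => ?_⟩
    · have := hx0 v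
      have := hy0 v
      simp only [Pi.add_apply, Pi.smul_apply, smul_eq_mul]
      positivity
    · simp only [Pi.add_apply, Pi.smul_apply, smul_eq_mul]
      rw [Finset.sum_add_distrib, ← Finset.mul_sum, ← Finset.mul_sum]
      nlinarith [hx K hK, hy K hK]
  refine convexHull_min ?_ hconv hx
  rintro x ⟨S, hS, rfl⟩
  refine ⟨fun v => Set.indicator_nonneg (by simp) v, fun K hK => ?_⟩
  simp only [Set.indicator_apply, Pi.one_apply]
  rw [Finset.sum_boole]
  norm_cast
  rw [Finset.card_le_one]
  intro a ha b hb
  simp only [Finset.mem_filter] at ha hb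
  by_contra hab
  exact hS a ha.2 b hb.2 (hK ha.1 hb.1 hab)

open Classical in
theorem stab_of_clique_ineq {V : Type*} [Fintype V] (G : SimpleGraph V) (hG : IsPerfect G)
    {x : V → ℝ} (hx0 : ∀ v, 0 ≤ x v)
    (hx : ∀ K : Finset V, G.IsClique ↑K → ∑ v ∈ K, x v ≤ 1) : x ∈ stab G := by
  have hclosed : IsClosed (stab G) := (stab_gen_finite G).isClosed_convexHull ℝ
  have hlim : Filter.Tendsto
      (fun N : ℕ => fun v => ((⌊x v * (N : ℝ)⌋₊ : ℕ) : ℝ) / (N : ℝ)) Filter.atTop (nhds x) := by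
    rw [tendsto_pi_nhds]
    intro v
    exact (tendsto_nat_floor_mul_div_atTop (hx0 v)).comp tendsto_natCast_atTop_atTop
  refine hclosed.mem_of_tendsto hlim ?_
  filter_upwards [Filter.eventually_gt_atTop 0] with N hN
  have hN' : (0 : ℝ) < N := by exact_mod_cast hN
  obtain ⟨c, hc, hcw⟩ := perfect_weighted G hG _ (fun v => ⌊x v * (N : ℝ)⌋₊) N rfl (by
    intro K hK
    have h1 : ((∑ v ∈ K, ⌊x v * (N : ℝ)⌋₊ : ℕ) : ℝ) ≤ N := by
      push_cast
      calc ∑ v ∈ K, ((⌊x v * (N : ℝ)⌋₊ : ℕ) : ℝ) ≤ ∑ v ∈ K, x v * N :=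
            Finset.sum_le_sum (fun v _ => Nat.floor_le (mul_nonneg (hx0 v) hN'.le))
        _ = (∑ v ∈ K, x v) * N := by rw [Finset.sum_mul]
        _ ≤ 1 * N := by gcongr; exact hx K hK
        _ = N := one_mul _
    exact_mod_cast h1)
  have hmem : ∑ i : Fin N, (1 / (N : ℝ)) • ((c i : Set V).indicator 1 : V → ℝ) ∈ stab G := by
    refine (convex_convexHull ℝ _).sum_mem (fun i _ => by positivity) ?_ ?_
    · simp; field_simp
    · intro i _
      exact subset_convexHull ℝ _ ⟨c i, fun u hu v hv => hc i u hu v hv, rfl⟩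
  convert hmem using 1
  funext v
  rw [← hcw v]
  simp only [Finset.sum_apply, Pi.smul_apply, smul_eq_mul, Set.indicator_apply, Pi.one_apply,
    ← Finset.mul_sum, Finset.mem_coe]
  push_cast
  ring

/-- A polyhedron given by finitely many inequalities has at most that many facets. -/
theorem polySize_le {κ J : Type*} [Fintype κ] [Fintype J] (a : J → κ → ℝ) (b : J → ℝ)
    (Q : Set (κ → ℝ)) (hQ : Q = {y | ∀ j, ∑ i, a j i * y i ≤ b j}) :
    polySize Q ≤ Fintype.card J := by
  have key : {F | IsFacet Q F} ⊆
      Set.range (fun j : J => {y ∈ Q | ∑ i, a j i * y i = b j}) := by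
    rintro F ⟨⟨hFQ, c, α, hcα, hF⟩, ⟨z, hz⟩, hne, hmax⟩
    have hex : ∃ j, (∀ y ∈ F, ∑ i, a j i * y i = b j) ∧ ∃ y ∈ Q, ∑ i, a j i * y i ≠ b j := by
      by_contra hcon
      push Not at hcon
      obtain ⟨y, hyQ, hyF⟩ : ∃ y ∈ Q, y ∉ F := by
        by_contra h
        push Not at h
        exact hne (Set.Subset.antisymm hFQ h)
      have hQ' : ∀ u ∈ Q, ∀ j, ∑ i, a j i * u i ≤ b j := by
        intro u hu; rw [hQ] at hu; exact hu
      have hyα : ∑ i, c i * y i < α := lt_of_le_of_ne (hcα y hyQ) (fun h => hyF (by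
        rw [hF]; exact ⟨hyQ, h⟩))
      have hp : ∀ j, ∃ p ∈ F, (∀ u ∈ Q, ∑ i, a j i * u i = b j) ∨ ∑ i, a j i * p i < b j := by
        intro j
        by_cases h : ∀ p ∈ F, ∑ i, a j i * p i = b j
        · exact ⟨z, hz, Or.inl (hcon j h)⟩
        · push Not at h
          obtain ⟨p, hpF, hpn⟩ := h
          exact ⟨p, hpF, Or.inr (lt_of_le_of_ne (hQ' p (hFQ hpF) j) hpn)⟩
      choose p hpF hp using hp
      -- linear functionals
      have lin : ∀ (d : κ → ℝ) (s t : ℝ) (u v : κ → ℝ),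
          ∑ i, d i * (s • u + t • v) i = s * ∑ i, d i * u i + t * ∑ i, d i * v i := by
        intro d s t u v
        rw [Finset.mul_sum, Finset.mul_sum, ← Finset.sum_add_distrib]
        refine Finset.sum_congr rfl (fun i _ => ?_)
        simp only [Pi.add_apply, Pi.smul_apply, smul_eq_mul]
        ring
      have hQconv : Convex ℝ Q := by
        intro u hu v hv s t hs ht hst
        have h1 := hQ' u hu
        have h2 := hQ' v hv
        rw [hQ]
        intro j
        rw [lin]
        have : b j = s * b j + t * b j := by rw [← add_mul, hst, one_mul]
        rw [this]
        exact add_le_add (mul_le_mul_of_nonneg_left (h1 j) hs) (mul_le_mul_of_nonneg_left (h2 j) ht)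
      have hFconv : Convex ℝ F := by
        intro u hu v hv s t hs ht hst
        rw [hF] at hu hv ⊢
        refine ⟨hQconv hu.1 hv.1 hs ht hst, ?_⟩
        rw [lin, hu.2, hv.2, ← add_mul, hst, one_mul]
      -- a relative interior point of F
      have hx : ∃ x ∈ F, ∀ j, (∀ u ∈ Q, ∑ i, a j i * u i = b j) ∨ ∑ i, a j i * x i < b j := by
        have : ∀ T : Finset J, ∃ x ∈ F, ∀ j ∈ T,
            (∀ u ∈ Q, ∑ i, a j i * u i = b j) ∨ ∑ i, a j i * x i < b j := by
          classical
          intro T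
          induction T using Finset.induction_on with
          | empty => exact ⟨z, hz, by simp⟩
          | insert j T _ ih =>
            obtain ⟨x, hxF, hx⟩ := ih
            refine ⟨(1/2 : ℝ) • x + (1/2 : ℝ) • p j,
              hFconv hxF (hpF j) (by norm_num) (by norm_num) (by norm_num), ?_⟩
            intro l hl
            rw [lin]
            have e1 := hQ' x (hFQ hxF) l
            have e2 := hQ' (p j) (hFQ (hpF j)) l
            rcases Finset.mem_insert.1 hl with rfl | hl
            · rcases hp l with h | h
              · exact Or.inl h
              · right; linarith
            · rcases hx l hl with h | h
              · exact Or.inl h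
              · right; linarith
        obtain ⟨x, hxF, hx⟩ := this Finset.univ
        exact ⟨x, hxF, fun j => hx j (Finset.mem_univ j)⟩
      obtain ⟨x, hxF, hx⟩ := hx
      have hev : ∀ᶠ ε : ℝ in nhdsWithin 0 (Set.Ioi 0), ∀ j,
          ∑ i, a j i * ((1 + ε) • x + (-ε) • y) i ≤ b j := by
        rw [Filter.eventually_all]
        intro j
        rcases hx j with h | h
        · filter_upwards with ε
          rw [lin, h x (hFQ hxF), h y hyQ]
          linarith
        · have hcont : Continuous (fun ε : ℝ =>
              (1 + ε) * ∑ i, a j i * x i + (-ε) * ∑ i, a j i * y i) := by fun_prop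
          have hlt : (fun ε : ℝ =>
              (1 + ε) * ∑ i, a j i * x i + (-ε) * ∑ i, a j i * y i) 0 < b j := by simpa using h
          have := (hcont.tendsto 0).eventually (gt_mem_nhds hlt)
          filter_upwards [this.filter_mono nhdsWithin_le_nhds] with ε hε
          rw [lin]
          exact hε.le
      obtain ⟨ε, hε, hε0⟩ := (hev.and self_mem_nhdsWithin).exists
      have hmem : (1 + ε) • x + (-ε) • y ∈ Q := by rw [hQ]; exact hε
      have h1 := hcα _ hmem
      rw [lin] at h1
      have h2 : ∑ i, c i * x i = α := by rw [hF] at hxF; exact hxF.2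
      rw [h2] at h1
      have : (0 : ℝ) < ε := hε0
      nlinarith
    obtain ⟨j, hj, y, hyQ, hy⟩ := hex
    refine ⟨j, hmax _ ⟨Set.sep_subset _ _, a j, b j, ?_, rfl⟩ ⟨z, hFQ hz, hj z hz⟩ ?_
      (fun u hu => ⟨hFQ hu, hj u hu⟩)⟩
    · intro u hu
      rw [hQ] at hu
      exact hu j
    · intro h
      rw [← h] at hyQ
      exact hy hyQ.2
  calc polySize Q ≤ (Set.range (fun j : J => {y ∈ Q | ∑ i, a j i * y i = b j})).ncard :=
        Set.ncard_le_ncard key (Set.finite_range _)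
    _ ≤ Fintype.card J := by
        rw [← Set.image_univ]
        refine (Set.ncard_image_le Set.finite_univ).trans ?_
        rw [Set.ncard_univ, Nat.card_eq_fintype_card]

theorem exists_maxClique {V : Type*} [Fintype V] (G : SimpleGraph V) (K : Finset V)
    (hK : G.IsClique ↑K) : ∃ M, IsMaxClique G M ∧ K ⊆ M := by
  obtain ⟨M, hKM, hM⟩ := (Set.toFinite {s : Finset V | G.IsClique ↑s}).exists_le_maximal hK
  exact ⟨M, ⟨hM.1, fun t ht hMt => hM.eq_of_le ht hMt⟩, hKM⟩

/-- for a perfect graph `G = (V, E)` with set `𝒞` of maximal cliques,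
`xc (STAB G) ≤ |V| + |𝒞|`. -/
theorem xc_stab_le_card_add_maxCliques {V : Type*} [Fintype V] (G : SimpleGraph V)
    (hG : IsPerfect G) :
    xc (stab G) ≤ Fintype.card V + {s : Finset V | IsMaxClique G s}.ncard := by
  classical
  let e : Fin (Fintype.card V) ≃ V := (Fintype.equivFin V).symm
  let L : (V → ℝ) ≃ₗ[ℝ] (Fin (Fintype.card V) → ℝ) := LinearEquiv.funCongrLeft ℝ ℝ e
  have hL : ∀ x i, L x i = x (e i) := fun x i => rfl
  let Q : Set (Fin (Fintype.card V) → ℝ) := L '' stab G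
  have hext : IsExtension (stab G) Q := by
    refine ⟨⟨L '' _, (stab_gen_finite G).image L, ?_⟩, L.symm.toLinearMap, ?_⟩
    · exact L.toLinearMap.image_convexHull _
    · simp [Q, Set.image_image]
  let J := V ⊕ {s : Finset V | IsMaxClique G s}
  let a : J → V → ℝ := Sum.elim (fun v u => if u = v then -1 else 0)
    (fun s u => if u ∈ s.1 then 1 else 0)
  let b : J → ℝ := Sum.elim (fun _ => 0) (fun _ => 1)
  have hstab : ∀ x, x ∈ stab G ↔ ∀ j, ∑ v, a j v * x v ≤ b j := by
    intro x
    constructor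
    · intro hx
      obtain ⟨h0, h1⟩ := clique_ineq_of_stab G hx
      rintro (v | s)
      · simpa [a, b] using h0 v
      · simpa [a, b] using h1 s.1 s.2.1
    · intro h
      have h0 : ∀ v, 0 ≤ x v := by
        intro v
        simpa [a, b] using h (Sum.inl v)
      refine stab_of_clique_ineq G hG h0 ?_
      intro K hK
      obtain ⟨M, hM, hKM⟩ := exists_maxClique G K hK
      refine (Finset.sum_le_sum_of_subset_of_nonneg hKM (fun v _ _ => h0 v)).trans ?_
      simpa [a, b] using h (Sum.inr ⟨M, hM⟩)
  have hsize : polySize Q ≤ Fintype.card J := by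
    refine polySize_le (fun j i => a j (e i)) b Q ?_
    ext y
    obtain ⟨x, rfl⟩ := L.surjective y
    have : L x ∈ Q ↔ x ∈ stab G := L.injective.mem_set_image
    rw [this, hstab x]
    refine forall_congr' (fun j => ?_)
    simp only [hL]
    rw [Equiv.sum_comp e (fun v => a j v * x v)]
  have hcard : Fintype.card J = Fintype.card V + {s : Finset V | IsMaxClique G s}.ncard := by
    rw [Fintype.card_sum, ← Nat.card_coe_set_eq, Nat.card_eq_fintype_card]
  rw [← hcard]
  have hle : xc (stab G) ≤ polySize Q := Nat.sInf_le ⟨_, Q, hext, rfl⟩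
  exact hle.trans hsize
end

section
/- Let G = (V,E) be a perfect graph and let V = V₁ ∪ V₂ be a partition of its vertex set. Let 𝒞₁₂ be the set of maximal cliques of G that meet both V₁ and V₂. Then xc(STAB(G)) ≤ xc(STAB(G[V₁])) + xc(STAB(G[V₂])) + |𝒞₁₂|. -/
section Aux

theorem isExposedFace_iff {κ : Type*} [Fintype κ] (Q F : Set (κ → ℝ)) :
    IsExposedFace Q F ↔ ∃ (f : (κ → ℝ) →ₗ[ℝ] ℝ) (α : ℝ), (∀ y ∈ Q, f y ≤ α) ∧
      F = {y ∈ Q | f y = α} := by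
  classical
  constructor
  · rintro ⟨-, c, α, h, rfl⟩
    refine ⟨∑ i, c i • LinearMap.proj i, α, ?_, ?_⟩
    · intro y hy; simpa using h y hy
    · simp
  · rintro ⟨f, α, h, rfl⟩
    have key : ∀ y, ∑ i, f (Pi.single i 1) * y i = f y := by
      intro y
      conv_rhs => rw [pi_eq_sum_univ' y]
      simp [mul_comm, Pi.single]
    refine ⟨fun y hy => hy.1, fun i => f (Pi.single i 1), α, ?_, ?_⟩
    · intro y hy; rw [key]; exact h y hy
    · simp only [key]

theorem farkas_aux {W : Type*} [AddCommGroup W] [Module ℝ W] {ι : Type*} [DecidableEq ι]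
    (s : Finset ι) : ∀ (a : ι → W →ₗ[ℝ] ℝ) (b : W →ₗ[ℝ] ℝ),
    (∀ x, (∀ i ∈ s, a i x ≤ 0) → b x ≤ 0) →
    ∃ l : ι → ℝ, (∀ i, 0 ≤ l i) ∧ b = ∑ i ∈ s, l i • a i := by
  induction s using Finset.induction_on with
  | empty =>
    intro a b h
    refine ⟨0, by simp, ?_⟩
    ext x
    have h1 := h x (by simp)
    have h2 := h (-x) (by simp)
    simp at h2 ⊢
    linarith
  | insert i₀ s hi ih =>
    intro a b h
    by_cases hb : ∀ x, (∀ i ∈ s, a i x ≤ 0) → b x ≤ 0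
    · obtain ⟨l, hl, e⟩ := ih a b hb
      refine ⟨fun i => if i = i₀ then 0 else l i, ?_, ?_⟩
      · intro i; dsimp only; split_ifs <;> simp [hl]
      · rw [Finset.sum_insert hi, e]
        simp only [if_true, zero_smul, zero_add]
        refine Finset.sum_congr rfl fun i his => ?_
        rw [if_neg]; rintro rfl; exact hi his
    · push Not at hb
      obtain ⟨u, hu, hbu⟩ := hb
      have h0 : 0 < a i₀ u := by
        by_contra hc
        push Not at hc
        have := h u (by
          intro i his
          rcases Finset.mem_insert.1 his with rfl | his
          · exact hc
          · exact hu i his)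
        linarith
      set t := a i₀ u with ht
      obtain ⟨l, hl, e⟩ := ih (fun i => a i - (a i u / t) • a i₀) (b - (b u / t) • a i₀) (by
        intro x hx
        have := h (x - (a i₀ x / t) • u) (by
          intro i his
          rcases Finset.mem_insert.1 his with rfl | his
          · simp only [map_sub, map_smul, smul_eq_mul, ← ht]
            field_simp; simp
          · have := hx i his
            simp only [LinearMap.sub_apply, LinearMap.smul_apply, map_sub, map_smul, smul_eq_mul] at this ⊢
            calc _ = _ := by ring
              _ ≤ _ := this)
        simp only [LinearMap.sub_apply, LinearMap.smul_apply, map_sub, map_smul, smul_eq_mul] at this ⊢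
        calc _ = _ := by ring
              _ ≤ _ := this)
      refine ⟨fun i => if i = i₀ then (b u - ∑ j ∈ s, l j * a j u) / t else l i, ?_, ?_⟩
      · intro i; dsimp only; split_ifs
        · apply div_nonneg _ h0.le
          have : ∑ j ∈ s, l j * a j u ≤ 0 :=
            Finset.sum_nonpos fun j hj => mul_nonpos_of_nonneg_of_nonpos (hl j) (hu j hj)
          linarith
        · exact hl i
      · rw [Finset.sum_insert hi]
        have e2 : ∑ i ∈ s, (if i = i₀ then (b u - ∑ j ∈ s, l j * a j u) / t else l i) • a i
            = ∑ i ∈ s, l i • a i := by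
          refine Finset.sum_congr rfl fun i his => ?_
          rw [if_neg]; rintro rfl; exact hi his
        rw [e2]
        have e3 : b = (b u / t) • a i₀ + ∑ i ∈ s, l i • (a i - (a i u / t) • a i₀) := by
          rw [← e]; abel
        ext x
        conv_lhs => rw [e3]
        simp only [if_true, LinearMap.add_apply, LinearMap.smul_apply, LinearMap.sum_apply,
          LinearMap.sub_apply, smul_eq_mul, mul_sub, Finset.sum_sub_distrib]
        have : ∑ j ∈ s, l j * (a j u / t * a i₀ x) = (∑ j ∈ s, l j * a j u) / t * a i₀ x := by
          rw [Finset.sum_div, Finset.sum_mul]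
          exact Finset.sum_congr rfl fun j _ => by ring
        rw [this]; ring

/-- An exposed face of the hull of a finite set is the hull of the points it contains. -/
theorem face_eq_hull {E : Type*} [AddCommGroup E] [Module ℝ E] (S : Finset E)
    (f : E →ₗ[ℝ] ℝ) (α : ℝ) (h : ∀ y ∈ convexHull ℝ (S : Set E), f y ≤ α) :
    {y ∈ convexHull ℝ (S : Set E) | f y = α} = convexHull ℝ {y ∈ (S : Set E) | f y = α} := by
  classical
  apply Set.Subset.antisymm
  · rintro y ⟨hy, hfy⟩
    obtain ⟨w, hw0, hw1, rfl⟩ := Finset.mem_convexHull'.1 hy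
    have h1 : ∑ s ∈ S, w s * (α - f s) = 0 := by
      simp only [mul_sub, Finset.sum_sub_distrib, ← Finset.sum_mul, hw1]
      rw [map_sum] at hfy
      simp only [map_smul, smul_eq_mul] at hfy
      rw [hfy]; ring
    have h2 : ∀ s ∈ S, w s * (α - f s) = 0 := by
      refine (Finset.sum_eq_zero_iff_of_nonneg fun s hs => ?_).1 h1
      exact mul_nonneg (hw0 s hs) (sub_nonneg.2 (h s (subset_convexHull ℝ _ hs)))
    have h3 : ∀ s ∈ S, w s ≠ 0 → f s = α := by
      intro s hs hne
      rcases mul_eq_zero.1 (h2 s hs) with h | h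
      · exact absurd h hne
      · linarith
    have : {y ∈ (S : Set E) | f y = α} = ((S.filter fun y => f y = α : Finset E) : Set E) := by
      ext; simp
    rw [this, Finset.mem_convexHull']
    refine ⟨w, fun y hy => hw0 y (Finset.mem_filter.1 hy).1, ?_, ?_⟩
    · rw [← hw1]
      apply Finset.sum_filter_of_ne
      exact fun s hs hne => h3 s hs hne
    · apply Finset.sum_filter_of_ne
      intro s hs hne
      exact h3 s hs (by rintro h; simp [h] at hne)
  · apply convexHull_min
    · rintro y ⟨hy, hfy⟩
      exact ⟨subset_convexHull ℝ _ hy, hfy⟩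
    · exact (convex_convexHull ℝ _).inter (convex_hyperplane (f.isLinear) α)

theorem faces_finite {κ : Type*} [Fintype κ] (Q : Set (κ → ℝ)) (hQ : IsPolytope Q) :
    {F | IsExposedFace Q F}.Finite := by
  classical
  obtain ⟨S, hS, rfl⟩ := hQ
  refine (hS.powerset.image (fun T => convexHull ℝ T)).subset ?_
  intro F hF
  obtain ⟨f, α, h, rfl⟩ := (isExposedFace_iff _ _).1 hF
  have := face_eq_hull hS.toFinset f α (by simpa using h)
  simp only [Set.Finite.coe_toFinset] at this
  exact ⟨_, fun y hy => hy.1, this.symm⟩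

theorem exists_facet {κ : Type*} [Fintype κ] (Q : Set (κ → ℝ)) (hQ : IsPolytope Q)
    (F : Set (κ → ℝ)) (hF : IsExposedFace Q F) (hne : F.Nonempty) (hp : F ≠ Q) :
    ∃ F', IsFacet Q F' ∧ F ⊆ F' := by
  have hfin : {F | IsExposedFace Q F ∧ F.Nonempty ∧ F ≠ Q}.Finite :=
    (faces_finite Q hQ).subset fun F h => h.1
  obtain ⟨M, hFM, hM⟩ := hfin.exists_le_maximal (a := F) ⟨hF, hne, hp⟩
  refine ⟨M, ⟨hM.1.1, hM.1.2.1, hM.1.2.2, ?_⟩, hFM⟩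
  intro F' h1 h2 h3 h4
  exact Set.Subset.antisymm (hM.2 ⟨h1, h2, h3⟩ h4) h4

theorem const_on_span {E : Type*} [AddCommGroup E] [Module ℝ E] (Q : Set E)
    (f : E →ₗ[ℝ] ℝ) (α : ℝ) (h : ∀ y ∈ Q, f y = α) (x : E) (hx : x ∈ affineSpan ℝ Q) :
    f x = α := by
  refine affineSpan_induction (p := fun x => f x = α) hx h ?_
  intro c u v w hu hv hw
  simp [hu, hv, hw]

/-- Given a point of the affine hull outside the polytope, some facet separates. -/
theorem exists_separating_facet {κ : Type*} [Fintype κ] (Q : Set (κ → ℝ)) (hQ : IsPolytope Q)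
    (x : κ → ℝ) (hx : x ∈ affineSpan ℝ Q) (hxQ : x ∉ Q) :
    ∃ F, IsFacet Q F ∧ ∀ (f : (κ → ℝ) →ₗ[ℝ] ℝ) (α : ℝ), (∀ y ∈ Q, f y ≤ α) →
      F = {y ∈ Q | f y = α} → α < f x := by
  classical
  obtain ⟨S', hS', hQS⟩ := id hQ
  obtain ⟨S, rfl⟩ := hS'.exists_finset_coe
  have hSQ : ∀ s ∈ S, s ∈ Q := fun s hs => hQS ▸ subset_convexHull ℝ _ hs
  have hconv : Convex ℝ Q := hQS ▸ convex_convexHull ℝ _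
  have hcomp : IsCompact Q := hQS ▸ hS'.isCompact_convexHull ℝ
  have hSne : S.Nonempty := by
    rw [Finset.nonempty_iff_ne_empty]
    rintro rfl
    simp [hQS] at hx
    exact AffineSubspace.notMem_bot ℝ _ _ hx
  have hcard : (0 : ℝ) < S.card := by exact_mod_cast hSne.card_pos
  set q : κ → ℝ := ∑ s ∈ S, (1 / (S.card : ℝ)) • s with hq
  have hqQ : q ∈ Q := by
    refine hconv.sum_mem (fun _ _ => by positivity) ?_ hSQ
    simp; field_simp
  -- value at q
  have hqlt : ∀ (f : (κ → ℝ) →ₗ[ℝ] ℝ) (α : ℝ), (∀ y ∈ Q, f y ≤ α) → f q = α → ∀ y ∈ Q, f y = α := by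
    intro f α h hfq
    have h1 : ∑ s ∈ S, (α - f s) = 0 := by
      rw [hq, map_sum] at hfq
      simp only [map_smul, smul_eq_mul, ← Finset.mul_sum] at hfq
      simp only [Finset.sum_sub_distrib, Finset.sum_const, nsmul_eq_mul]
      rw [← hfq]; field_simp; ring
    have h2 := (Finset.sum_eq_zero_iff_of_nonneg fun s hs => sub_nonneg.2 (h s (hSQ s hs))).1 h1
    intro y hy
    rw [hQS] at hy
    refine const_on_span _ f α (fun s hs => ?_) y (convexHull_subset_affineSpan _ hy)
    have := h2 s hs
    linarith
  -- exit point
  set g : ℝ → (κ → ℝ) := fun t => q + t • (x - q) with hg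
  have hgc : Continuous g := by fun_prop
  have hT : IsCompact (Set.Icc (0 : ℝ) 1 ∩ g ⁻¹' Q) :=
    isCompact_Icc.inter_right (hcomp.isClosed.preimage hgc)
  obtain ⟨t, ⟨⟨ht0, ht1⟩, htQ⟩, htmax⟩ := hT.exists_isGreatest ⟨0, by simp [hg, hqQ]⟩
  have htlt : t < 1 := by
    refine lt_of_le_of_ne ht1 ?_
    rintro rfl
    apply hxQ
    simpa [hg] using htQ
  set z := g t with hz
  -- functional
  have hF : ∃ c : κ → ℝ, (∀ s ∈ S, c ⬝ᵥ (s - z) ≤ 0) ∧ 0 < c ⬝ᵥ (x - z) := by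
    by_contra hcon
    push Not at hcon
    let a : (κ → ℝ) → (κ → ℝ) →ₗ[ℝ] ℝ := fun p => ∑ i, p i • LinearMap.proj i
    have ha : ∀ p c, a p c = c ⬝ᵥ p := by
      intro p c; simp [a, dotProduct, mul_comm]
    obtain ⟨l, hl, e⟩ := farkas_aux S (fun s => a (s - z)) (a (x - z)) (by
      intro c hc
      rw [ha]
      exact hcon c (fun s hs => by rw [← ha]; exact hc s hs))
    have e2 : x - z = ∑ s ∈ S, l s • (s - z) := by
      ext i
      have := LinearMap.congr_fun e (Pi.single i 1)
      simpa [ha, Finset.sum_apply] using this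
    set L := ∑ s ∈ S, l s with hL
    have hL0 : 0 ≤ L := Finset.sum_nonneg fun s _ => hl s
    have hmem : z + (1 / (1 + L)) • (x - z) ∈ Q := by
      have : z + (1 / (1 + L)) • (x - z) =
          (1 / (1 + L)) • z + ∑ s ∈ S, (l s / (1 + L)) • s := by
        rw [e2]
        simp only [smul_sub, Finset.sum_sub_distrib, ← Finset.sum_smul, ← hL, Finset.smul_sum, smul_smul]
        have h1 : z = (1 / (1 + L)) • z + (1 / (1 + L) * L) • z := by
          rw [← add_smul]
          have : 1 / (1 + L) + 1 / (1 + L) * L = 1 := by field_simp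
          rw [this, one_smul]
        have h2 : ∀ s : κ → ℝ, (1 / (1 + L) * l s) • s = (l s / (1 + L)) • s := by
          intro s; congr 1; ring
        simp only [h2]
        conv_lhs => enter [1]; rw [h1]
        abel
      rw [this]
      have hh := hconv.sum_mem (t := Finset.insertNone S) (w := fun o => o.elim (1 / (1 + L)) fun s => l s / (1 + L))
        (z := fun o => o.elim z id) (by
          rintro (_ | s) _
          · simp; positivity
          · simp; exact div_nonneg (hl s) (by positivity)) (by
          simp [Finset.sum_insertNone, ← Finset.sum_div, ← hL]; field_simp) (by
          rintro (_ | s) hs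
          · exact htQ
          · exact hSQ s (by simpa using hs))
      simpa [Finset.sum_insertNone] using hh
    have hxz : x - z = (1 - t) • (x - q) := by
      simp only [hz, hg, sub_smul, one_smul]; abel
    have hε : 0 < 1 / (1 + L) := by positivity
    have hε1 : 1 / (1 + L) ≤ 1 := by
      rw [div_le_one (by positivity)]; linarith
    have := htmax (a := t + 1 / (1 + L) * (1 - t)) ⟨⟨by nlinarith, by nlinarith⟩, by
      have : g (t + 1 / (1 + L) * (1 - t)) = z + (1 / (1 + L)) • (x - z) := by
        rw [hxz, smul_smul, hz]
        simp only [hg, add_smul, add_assoc]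
      rw [Set.mem_preimage, this]; exact hmem⟩
    nlinarith
  obtain ⟨c, hc, hcx⟩ := hF
  let f : (κ → ℝ) →ₗ[ℝ] ℝ := ∑ i, c i • LinearMap.proj i
  have hf : ∀ p, f p = c ⬝ᵥ p := by intro p; simp [f, dotProduct]
  have hfQ : ∀ y ∈ Q, f y ≤ f z := by
    have : Q ⊆ {y | f y ≤ f z} := by
      rw [hQS]
      refine convexHull_min (fun s hs => ?_) (convex_halfSpace_le f.isLinear _)
      have := hc s hs
      rw [← hf, map_sub] at this
      simpa using this
    exact this
  rw [← hf, map_sub] at hcx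
  obtain ⟨F, hFF, hsub⟩ := exists_facet Q hQ {y ∈ Q | f y = f z}
    ((isExposedFace_iff _ _).2 ⟨f, f z, hfQ, rfl⟩) ⟨z, htQ, rfl⟩ (by
      intro he
      have := const_on_span Q f (f z) (fun y hy => by rw [← he] at hy; exact hy.2) x hx
      linarith)
  refine ⟨F, hFF, ?_⟩
  intro f' α hα hFe
  have hz' : f' z = α := by
    have : z ∈ F := hsub ⟨htQ, rfl⟩
    rw [hFe] at this; exact this.2
  have hq' : f' q < α := by
    refine lt_of_le_of_ne (hα q hqQ) fun he => ?_
    apply hFF.2.2.1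
    rw [hFe]
    ext y
    exact ⟨fun h => h.1, fun h => ⟨h, hqlt f' α hα he y h⟩⟩
  have : f' z = f' q + t * (f' x - f' q) := by simp [hz, hg]
  by_contra hcon
  push Not at hcon
  nlinarith

end Aux

section AuxB

/-- The polyhedron given by an affine subspace and finitely many inequalities. -/
def polyhedron {E J : Type*} [AddCommGroup E] [Module ℝ E] (A : AffineSubspace ℝ E)
    (f : J → E →ₗ[ℝ] ℝ) (α : J → ℝ) : Set E := {y | y ∈ A ∧ ∀ j, f j y ≤ α j}

theorem ray_mem {E J : Type*} [AddCommGroup E] [Module ℝ E] [Finite J] (A : AffineSubspace ℝ E)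
    (f : J → E →ₗ[ℝ] ℝ) (α : J → ℝ) (z p : E) (hz : z ∈ polyhedron A f α)
    (hp : p ∈ polyhedron A f α) (h : ∀ j, f j z < α j ∨ f j p = f j z) :
    ∃ ε > (0 : ℝ), z + ε • (z - p) ∈ polyhedron A f α := by
  have h1 : ∀ j, ∀ᶠ ε in nhdsWithin (0 : ℝ) (Set.Ioi 0), f j (z + ε • (z - p)) ≤ α j := by
    intro j
    rcases h j with hj | hj
    · have hc : Filter.Tendsto (fun ε : ℝ => f j z + ε * (f j z - f j p))
          (nhds (0 : ℝ)) (nhds (f j z + 0 * (f j z - f j p))) := by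
        apply Continuous.tendsto
        fun_prop
      have := (hc.mono_left nhdsWithin_le_nhds).eventually_lt_const
        (l := nhdsWithin (0 : ℝ) (Set.Ioi 0)) (u := α j) (by simpa using hj)
      filter_upwards [this] with ε hε
      simpa using hε.le
    · filter_upwards with ε
      simpa [hj] using hz.2 j
  have h2 := (Filter.eventually_all.2 h1).and (self_mem_nhdsWithin (s := Set.Ioi (0 : ℝ)))
  obtain ⟨ε, hε, hpos⟩ := h2.exists
  refine ⟨ε, hpos, ?_, hε⟩
  have := AffineSubspace.smul_vsub_vadd_mem A ε hz.1 hp.1 hz.1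
  simpa [add_comm] using this

theorem polyhedron_convex {E J : Type*} [AddCommGroup E] [Module ℝ E] (A : AffineSubspace ℝ E)
    (f : J → E →ₗ[ℝ] ℝ) (α : J → ℝ) : Convex ℝ (polyhedron A f α) := by
  have : polyhedron A f α = (A : Set E) ∩ ⋂ j, {y | f j y ≤ α j} := by
    ext; simp [polyhedron]
  rw [this]
  exact A.convex.inter (convex_iInter fun j => convex_halfSpace_le (f j).isLinear _)

theorem polyhedron_polytope {κ J : Type*} [Fintype κ] [Finite J] (A : AffineSubspace ℝ (κ → ℝ))
    (f : J → (κ → ℝ) →ₗ[ℝ] ℝ) (α : J → ℝ) (hc : IsCompact (polyhedron A f α)) :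
    IsPolytope (polyhedron A f α) := by
  have hfin : (Set.extremePoints ℝ (polyhedron A f α)).Finite := by
    refine Set.Finite.of_injOn (f := fun x => {j | f j x = α j}) (t := Set.univ)
      (fun _ _ => Set.mem_univ _) ?_ Set.finite_univ
    intro x hx y hy hxy
    obtain ⟨ε, hε, hm⟩ := ray_mem A f α x y hx.1 hy.1 (by
      intro j
      by_cases hj : f j x = α j
      · right
        have : j ∈ {j | f j y = α j} := (Set.ext_iff.1 hxy j).1 hj
        rw [hj]; exact this
      · left; exact lt_of_le_of_ne (hx.1.2 j) hj)
    have := (mem_extremePoints.1 hx).2 y hy.1 _ hm (by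
      refine ⟨ε / (1 + ε), 1 / (1 + ε), by positivity, by positivity, by field_simp; ring, ?_⟩
      ext i
      simp
      field_simp
      ring)
    exact this.1.symm
  refine ⟨_, hfin, ?_⟩
  have := closure_convexHull_extremePoints hc (polyhedron_convex A f α)
  rw [(hfin.isClosed_convexHull ℝ).closure_eq] at this
  exact this.symm

theorem polyhedron_size {κ J : Type*} [Fintype κ] [Fintype J] (A : AffineSubspace ℝ (κ → ℝ))
    (f : J → (κ → ℝ) →ₗ[ℝ] ℝ) (α : J → ℝ) :
    polySize (polyhedron A f α) ≤ Fintype.card J := by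
  classical
  set Q := polyhedron A f α with hQ
  have hsub : {F | IsFacet Q F} ⊆ Set.range fun j => {y ∈ Q | f j y = α j} := by
    intro F hF
    obtain ⟨g, β, hg, hFe⟩ := (isExposedFace_iff _ _).1 hF.1
    by_contra hcon
    have h1 : ∀ j, ∃ y ∈ F, f j y < α j ∨ ∀ p ∈ Q, f j p = α j := by
      intro j
      by_contra hj
      push Not at hj
      apply hcon
      refine ⟨j, ?_⟩
      have hFj : F ⊆ {y ∈ Q | f j y = α j} := fun y hy =>
        ⟨hF.1.1 hy, le_antisymm ((hF.1.1 hy).2 j) (hj y hy).1⟩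
      refine hF.2.2.2 _ ((isExposedFace_iff _ _).2 ⟨f j, α j, fun y hy => hy.2 j, rfl⟩)
        (hF.2.1.mono hFj) ?_ hFj
      intro he
      obtain ⟨y, hy⟩ := hF.2.1
      obtain ⟨p, hp, hne⟩ := (hj y hy).2
      rw [← he] at hp
      exact hne hp.2
    choose y hy hy' using h1
    obtain ⟨y₀, hy₀⟩ := hF.2.1
    have hFconv : Convex ℝ F := by
      rw [hFe]
      exact (polyhedron_convex A f α).inter (convex_hyperplane g.isLinear β)
    set N : ℝ := Fintype.card J + 1 with hN
    have hNpos : 0 < N := by positivity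
    let Y : Option J → κ → ℝ := fun o => o.elim y₀ y
    have hY : ∀ o, Y o ∈ F := by rintro (_ | j); exacts [hy₀, hy j]
    set z : κ → ℝ := ∑ o, (1 / N) • Y o with hz
    have hzF : z ∈ F := by
      refine hFconv.sum_mem (fun _ _ => by positivity) ?_ (fun o _ => hY o)
      simp [hN]; field_simp
    have hzQ := hF.1.1 hzF
    obtain ⟨p, hpQ, hpF⟩ : ∃ p ∈ Q, p ∉ F := by
      by_contra h
      push Not at h
      exact hF.2.2.1 (Set.Subset.antisymm hF.1.1 h)
    obtain ⟨ε, hε, hm⟩ := ray_mem A f α z p hzQ hpQ (by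
      intro j
      rcases hy' j with h | h
      · left
        rw [hz, map_sum]
        calc ∑ o, f j ((1 / N) • Y o) < ∑ o : Option J, (1 / N) * α j := by
              apply Finset.sum_lt_sum
              · intro o _
                rw [map_smul, smul_eq_mul]
                exact mul_le_mul_of_nonneg_left ((hF.1.1 (hY o)).2 j) (by positivity)
              · refine ⟨some j, Finset.mem_univ _, ?_⟩
                rw [map_smul, smul_eq_mul]
                exact mul_lt_mul_of_pos_left h (by positivity)
          _ = α j := by simp [hN]; field_simp
      · right
        rw [h p hpQ, h z hzQ])
    have h2 := hg _ hm
    have hgz : g z = β := by rw [hFe] at hzF; exact hzF.2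
    have hgp : g p < β := by
      refine lt_of_le_of_ne (hg p hpQ) fun he => hpF ?_
      rw [hFe]; exact ⟨hpQ, he⟩
    simp [hgz] at h2
    nlinarith
  calc polySize Q ≤ (Set.range fun j => {y ∈ Q | f j y = α j}).ncard :=
        Set.ncard_le_ncard hsub (Set.finite_range _)
    _ ≤ Fintype.card J := by
        rw [← Set.image_univ]
        refine (Set.ncard_image_le Set.finite_univ).trans ?_
        simp [Set.ncard_univ]

/-- Every polytope is a polyhedron with one inequality per facet. -/
theorem polytope_eq_polyhedron {κ : Type*} [Fintype κ] (Q : Set (κ → ℝ)) (hQ : IsPolytope Q) :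
    ∃ (f : Fin (polySize Q) → (κ → ℝ) →ₗ[ℝ] ℝ) (α : Fin (polySize Q) → ℝ),
      Q = polyhedron (affineSpan ℝ Q) f α := by
  classical
  have hfin : {F | IsFacet Q F}.Finite := (faces_finite Q hQ).subset fun F h => h.1
  have : Finite {F | IsFacet Q F} := hfin
  have e : Fin (polySize Q) ≃ {F | IsFacet Q F} := (Finite.equivFinOfCardEq rfl).symm
  have h1 : ∀ F : {F | IsFacet Q F}, ∃ (f : (κ → ℝ) →ₗ[ℝ] ℝ) (α : ℝ), (∀ y ∈ Q, f y ≤ α) ∧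
      F.1 = {y ∈ Q | f y = α} := fun F => (isExposedFace_iff _ _).1 F.2.1
  choose f α h hF using h1
  refine ⟨fun i => f (e i), fun i => α (e i), ?_⟩
  apply Set.Subset.antisymm
  · intro y hy
    exact ⟨subset_affineSpan ℝ _ hy, fun j => h _ y hy⟩
  · rintro y ⟨hy, hj⟩
    by_contra hyQ
    obtain ⟨F, hFF, hs⟩ := exists_separating_facet Q hQ y hy hyQ
    have h2 := hs (f ⟨F, hFF⟩) (α ⟨F, hFF⟩) (h _) (hF ⟨F, hFF⟩)
    have h3 := hj (e.symm ⟨F, hFF⟩)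
    simp at h3
    linarith

theorem xc_le_card {ι E J : Type*} [Fintype ι] [Fintype J] [NormedAddCommGroup E]
    [NormedSpace ℝ E] [FiniteDimensional ℝ E] (P : Set (ι → ℝ)) (A : AffineSubspace ℝ E)
    (f : J → E →ₗ[ℝ] ℝ) (α : J → ℝ) (hc : IsCompact (polyhedron A f α))
    (π : E →ₗ[ℝ] (ι → ℝ)) (hπ : π '' polyhedron A f α = P) :
    xc P ≤ Fintype.card J := by
  let e : E ≃ₗ[ℝ] (Fin (Module.finrank ℝ E) → ℝ) := (Module.finBasis ℝ E).equivFun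
  set Q := polyhedron (A.map e.toLinearMap.toAffineMap) (fun j => (f j).comp e.symm.toLinearMap) α
    with hQ
  have hQe : Q = e '' polyhedron A f α := by
    ext y
    constructor
    · rintro ⟨⟨x, hx, rfl⟩, h⟩
      exact ⟨x, ⟨hx, fun j => by simpa using h j⟩, rfl⟩
    · rintro ⟨x, ⟨hx, h⟩, rfl⟩
      exact ⟨⟨x, hx, rfl⟩, fun j => by simpa using h j⟩
  have hQc : IsCompact Q := by
    rw [hQe]
    exact hc.image (LinearMap.continuous_of_finiteDimensional e.toLinearMap)
  have hext : IsExtension P Q := by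
    refine ⟨polyhedron_polytope _ _ _ hQc, π.comp e.symm.toLinearMap, ?_⟩
    rw [hQe, ← hπ, Set.image_image]
    simp
  have h1 : xc P ≤ polySize Q := Nat.sInf_le ⟨_, Q, hext, rfl⟩
  exact h1.trans (polyhedron_size _ _ _)

theorem xc_attained {ι : Type*} [Fintype ι] (P : Set (ι → ℝ)) (hP : IsPolytope P) :
    ∃ (k : ℕ) (Q : Set (Fin k → ℝ)), IsExtension P Q ∧ polySize Q = xc P := by
  classical
  apply Nat.sInf_mem (s := {r : ℕ | ∃ (k : ℕ) (Q : Set (Fin k → ℝ)), IsExtension P Q ∧ polySize Q = r})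
  let e : (ι → ℝ) ≃ₗ[ℝ] (Fin (Fintype.card ι) → ℝ) :=
    LinearEquiv.funCongrLeft ℝ ℝ (Fintype.equivFin ι).symm
  obtain ⟨S, hS, rfl⟩ := hP
  refine ⟨_, _, e '' convexHull ℝ S, ⟨⟨e '' S, hS.image _, ?_⟩, e.symm.toLinearMap, ?_⟩, rfl⟩
  · exact e.toLinearMap.image_convexHull S
  · rw [Set.image_image]; simp

end AuxB

section AuxC

theorem weighted_coloring {V : Type*} [Fintype V] [DecidableEq V] (G : SimpleGraph V)
    (hG : IsPerfect G) : ∀ (m : ℕ) (w : V → ℕ), ∑ v, w v = m → ∀ N : ℕ,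
    (∀ K : Finset V, G.IsClique ↑K → ∑ v ∈ K, w v ≤ N) →
    ∃ S : Fin N → Finset V, (∀ i, ∀ u ∈ S i, ∀ v ∈ S i, ¬ G.Adj u v) ∧
      ∀ v, ∑ i, (if v ∈ S i then 1 else 0) = w v := by
  intro m
  induction m using Nat.strong_induction_on with
  | _ m ih =>
  intro w hw N hN
  by_cases h1 : ∀ v, w v ≤ 1
  · let T : Set V := {v | w v = 1}
    have hle : cliqueNum (G.induce T) ≤ N := by
      refine csSup_le ⟨0, ∅, by simp [SimpleGraph.isNClique_iff]⟩ ?_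
      rintro n ⟨s, hs⟩
      have hcl : G.IsClique ↑(s.map (Function.Embedding.subtype _)) := by
        have := hs.isClique
        intro a ha b hb hab
        simp only [Finset.coe_map, Set.mem_image, Finset.mem_coe] at ha hb
        obtain ⟨a, ha, rfl⟩ := ha
        obtain ⟨b, hb, rfl⟩ := hb
        exact this ha hb (fun h => hab (by rw [h]))
      have h2 := hN _ hcl
      rw [Finset.sum_map] at h2
      rw [← hs.card_eq]
      calc s.card = ∑ v ∈ s, w v.1 := by
            rw [Finset.card_eq_sum_ones]
            exact Finset.sum_congr rfl fun v _ => v.2.symm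
        _ ≤ N := h2
    have hcol : (G.induce T).Colorable N := by
      rw [← SimpleGraph.chromaticNumber_le_iff_colorable, hG T]
      exact_mod_cast hle
    obtain ⟨col⟩ := hcol
    refine ⟨fun i => Finset.univ.filter fun v => ∃ h : v ∈ T, col ⟨v, h⟩ = i, ?_, ?_⟩
    · intro i u hu v hv hadj
      simp only [Finset.mem_filter, Finset.mem_univ, true_and] at hu hv
      obtain ⟨hu, hu'⟩ := hu
      obtain ⟨hv, hv'⟩ := hv
      exact col.valid (v := ⟨u, hu⟩) (w := ⟨v, hv⟩) hadj (hu'.trans hv'.symm)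
    · intro v
      by_cases hv : v ∈ T
      · have : w v = 1 := hv
        simp [hv, this]
      · have : w v = 0 := by
          have := h1 v
          have h3 : w v ≠ 1 := hv
          omega
        simp [hv, this]
  · push Not at h1
    obtain ⟨v, hv⟩ := h1
    set w' : V → ℕ := fun u => if u = v then w u - 1 else w u with hw'
    have hle : ∀ u, w' u ≤ w u := by intro u; simp only [hw']; split_ifs <;> omega
    have hlt : ∑ u, w' u < m := by
      rw [← hw]
      exact Finset.sum_lt_sum (fun u _ => hle u) ⟨v, Finset.mem_univ _, by simp [hw']; omega⟩
    obtain ⟨S, hS, hSw⟩ := ih _ hlt w' rfl N (fun K hK =>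
      (Finset.sum_le_sum fun u _ => hle u).trans (hN K hK))
    obtain ⟨i₀, hi₀⟩ : ∃ i, v ∈ S i := by
      by_contra hcon
      push Not at hcon
      have := hSw v
      simp [hcon, hw'] at this
      omega
    obtain ⟨M, rfl⟩ : ∃ M, N = M + 1 := by
      cases N with
      | zero => exact i₀.elim0
      | succ M => exact ⟨M, rfl⟩
    set w'' : V → ℕ := fun u => w u - (if u ∈ S i₀ then 1 else 0) with hw''
    have hpos : ∀ u ∈ S i₀, 1 ≤ w u := by
      intro u hu
      refine le_trans ?_ (hle u)
      rw [← hSw u]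
      calc 1 = (if u ∈ S i₀ then 1 else 0) := by simp [hu]
        _ ≤ _ := Finset.single_le_sum (f := fun i => if u ∈ S i then 1 else 0)
          (fun _ _ => Nat.zero_le _) (Finset.mem_univ i₀)
    have hle2 : ∀ u, w'' u ≤ w u := fun u => Nat.sub_le _ _
    have hlt2 : ∑ u, w'' u < m := by
      rw [← hw]
      exact Finset.sum_lt_sum (fun u _ => hle2 u) ⟨v, Finset.mem_univ _, by simp [hw'', hi₀]; omega⟩
    have hbound : ∀ K : Finset V, G.IsClique ↑K → ∑ u ∈ K, w'' u ≤ M := by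
      intro K hK
      by_cases hmeet : ∃ u ∈ K, u ∈ S i₀
      · obtain ⟨u, huK, huS⟩ := hmeet
        have : ∑ u ∈ K, w'' u < ∑ u ∈ K, w u :=
          Finset.sum_lt_sum (fun u _ => hle2 u) ⟨u, huK, by
            have := hpos u huS
            simp [hw'', huS]; omega⟩
        have := hN K hK
        omega
      · push Not at hmeet
        have e1 : ∑ u ∈ K, w'' u ≤ ∑ u ∈ K, w' u := by
          refine Finset.sum_le_sum fun u hu => ?_
          have : u ≠ v := by rintro rfl; exact hmeet _ hu hi₀
          simp [hw'', hw', this]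
        refine e1.trans ?_
        have e2 : ∑ u ∈ K, w' u = ∑ i, (K ∩ S i).card := by
          simp_rw [← hSw]
          rw [Finset.sum_comm]
          refine Finset.sum_congr rfl fun i _ => ?_
          rw [Finset.sum_ite_mem, Finset.card_eq_sum_ones]
        rw [e2]
        have e3 : ∀ i, (K ∩ S i).card ≤ 1 := by
          intro i
          rw [Finset.card_le_one]
          intro a ha b hb
          rw [Finset.mem_inter] at ha hb
          by_contra hab
          exact hS i a ha.2 b hb.2 (hK ha.1 hb.1 hab)
        have e4 : (K ∩ S i₀).card = 0 := by
          rw [Finset.card_eq_zero, Finset.eq_empty_iff_forall_notMem]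
          intro a ha
          rw [Finset.mem_inter] at ha
          exact hmeet a ha.1 ha.2
        have : ∑ i, (K ∩ S i).card < ∑ i : Fin (M + 1), 1 :=
          Finset.sum_lt_sum (fun i _ => e3 i) ⟨i₀, Finset.mem_univ _, by omega⟩
        simp at this
        omega
    obtain ⟨R, hR, hRw⟩ := ih _ hlt2 w'' rfl M hbound
    refine ⟨Fin.cons (S i₀) R, ?_, ?_⟩
    · intro i
      refine Fin.cases ?_ (fun i => ?_) i
      · simpa using hS i₀
      · simpa using hR i
    · intro u
      rw [Fin.sum_univ_succ]
      simp only [Fin.cons_zero, Fin.cons_succ, hRw u, hw'']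
      split_ifs with hu
      · have := hpos u hu; omega
      · omega

theorem stab_polytope {V : Type*} [Fintype V] (G : SimpleGraph V) : IsPolytope (stab G) := by
  refine ⟨_, ?_, rfl⟩
  refine (Set.finite_range fun S : Set V => (S.indicator 1 : V → ℝ)).subset ?_
  rintro x ⟨S, -, rfl⟩
  exact ⟨S, rfl⟩

theorem stab_closed {V : Type*} [Fintype V] (G : SimpleGraph V) : IsClosed (stab G) := by
  obtain ⟨S, hS, e⟩ := stab_polytope G
  rw [e]; exact hS.isClosed_convexHull ℝ

theorem mem_stab_of_clique {V : Type*} [Fintype V] (G : SimpleGraph V)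
    (hG : IsPerfect G) (x : V → ℝ) (hx : ∀ v, 0 ≤ x v)
    (hK : ∀ K : Finset V, G.IsClique ↑K → ∑ v ∈ K, x v ≤ 1) : x ∈ stab G := by
  classical
  have hlim : Filter.Tendsto (fun (n : ℕ) (v : V) => (⌊x v * (n : ℝ)⌋₊ : ℝ) / (n : ℝ)) Filter.atTop
      (nhds x) := by
    rw [tendsto_pi_nhds]
    intro v
    exact (tendsto_nat_floor_mul_div_atTop (hx v)).comp tendsto_natCast_atTop_atTop
  refine (stab_closed G).mem_of_tendsto hlim ?_
  filter_upwards [Filter.eventually_gt_atTop 0] with n hn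
  have hn' : (0 : ℝ) < n := by exact_mod_cast hn
  obtain ⟨S, hS, hSw⟩ := weighted_coloring G hG _ (fun v => ⌊x v * (n : ℝ)⌋₊) rfl n (by
    intro K hKc
    have : (∑ v ∈ K, (⌊x v * (n : ℝ)⌋₊ : ℝ)) ≤ n := by
      calc _ ≤ ∑ v ∈ K, x v * n := Finset.sum_le_sum fun v _ =>
            Nat.floor_le (mul_nonneg (hx v) hn'.le)
        _ = (∑ v ∈ K, x v) * n := by rw [Finset.sum_mul]
        _ ≤ 1 * n := mul_le_mul_of_nonneg_right (hK K hKc) hn'.le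
        _ = n := one_mul _
    exact_mod_cast this)
  have e : (fun v => (⌊x v * (n : ℝ)⌋₊ : ℝ) / (n : ℝ)) =
      ∑ i : Fin n, (1 / (n : ℝ)) • ((S i : Set V).indicator 1 : V → ℝ) := by
    ext v
    rw [← hSw v]
    push_cast
    rw [Finset.sum_apply, Finset.sum_div]
    refine Finset.sum_congr rfl fun i _ => ?_
    by_cases hv : v ∈ S i <;> simp [hv]
  rw [e]
  refine (convex_convexHull ℝ _).sum_mem (fun _ _ => by positivity) ?_ fun i _ => ?_
  · simp; field_simp
  · exact subset_convexHull ℝ _ ⟨S i, fun u hu v hv => hS i u hu v hv, rfl⟩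

theorem stab_nonneg {V : Type*} [Fintype V] (G : SimpleGraph V) (x : V → ℝ) (hx : x ∈ stab G)
    (v : V) : 0 ≤ x v := by
  have : stab G ⊆ {x | 0 ≤ (LinearMap.proj v : (V → ℝ) →ₗ[ℝ] ℝ) x} := by
    refine convexHull_min ?_ (convex_halfSpace_ge (LinearMap.isLinear _) _)
    rintro x ⟨S, -, rfl⟩
    exact Set.indicator_nonneg (fun _ _ => zero_le_one (α := ℝ)) v
  exact this hx

theorem stab_clique {V : Type*} [Fintype V] (G : SimpleGraph V) (x : V → ℝ) (hx : x ∈ stab G)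
    (K : Finset V) (hK : G.IsClique ↑K) : ∑ v ∈ K, x v ≤ 1 := by
  classical
  have : stab G ⊆ {x | (∑ v ∈ K, (LinearMap.proj v : (V → ℝ) →ₗ[ℝ] ℝ)) x ≤ 1} := by
    refine convexHull_min ?_ (convex_halfSpace_le (LinearMap.isLinear _) _)
    rintro x ⟨S, hS, rfl⟩
    simp only [Set.mem_ofPred_eq, LinearMap.sum_apply, LinearMap.proj_apply, Set.indicator_apply,
      Pi.one_apply, Finset.sum_boole]
    have : (K.filter fun v => v ∈ S).card ≤ 1 := by
      rw [Finset.card_le_one]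
      intro a ha b hb
      rw [Finset.mem_filter] at ha hb
      by_contra hab
      exact hS a ha.2 b hb.2 (hK ha.1 hb.1 hab)
    exact_mod_cast this
  simpa using this hx

theorem stab_restrict {V : Type*} [Fintype V] (G : SimpleGraph V) (T : Set V) [Fintype T]
    (x : V → ℝ) (hx : x ∈ stab G) : (fun v : T => x v) ∈ stab (G.induce T) := by
  have h1 : (LinearMap.funLeft ℝ ℝ (Subtype.val : T → V)) '' stab G ⊆ stab (G.induce T) := by
    rw [stab, LinearMap.image_convexHull]
    apply convexHull_mono
    rintro _ ⟨x, ⟨S, hS, rfl⟩, rfl⟩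
    refine ⟨Subtype.val ⁻¹' S, fun u hu v hv hadj => hS u hu v hv hadj, ?_⟩
    ext v
    by_cases hv : v.1 ∈ S <;> simp [LinearMap.funLeft, hv]
  exact h1 ⟨x, hx, rfl⟩

theorem clique_of_subset {V : Type*} [Fintype V] (G : SimpleGraph V) (T : Set V) [Fintype T]
    (x : V → ℝ) (hx : (fun v : T => x v) ∈ stab (G.induce T)) (K : Finset V)
    (hK : G.IsClique ↑K) (hKT : ∀ v ∈ K, v ∈ T) : ∑ v ∈ K, x v ≤ 1 := by
  classical
  have := stab_clique _ _ hx (K.subtype (· ∈ T)) (by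
    intro a ha b hb hab
    simp only [Finset.mem_coe, Finset.mem_subtype] at ha hb
    exact hK ha hb (fun h => hab (Subtype.ext h)))
  rw [Finset.sum_subtype_of_mem (f := x) hKT] at this
  exact this

theorem mem_stab_iff {V : Type*} [Fintype V] [DecidableEq V]
    (G : SimpleGraph V) (hG : IsPerfect G)
    (V₁ V₂ : Finset V) (hunion : V₁ ∪ V₂ = Finset.univ) (x : V → ℝ) :
    x ∈ stab G ↔ (fun v : (V₁ : Set V) => x v) ∈ stab (G.induce (V₁ : Set V)) ∧
      (fun v : (V₂ : Set V) => x v) ∈ stab (G.induce (V₂ : Set V)) ∧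
      ∀ s : Finset V, (IsMaxClique G s ∧ (∃ v ∈ s, v ∈ V₁) ∧ (∃ v ∈ s, v ∈ V₂)) →
        ∑ v ∈ s, x v ≤ 1 := by
  have hcov : ∀ v, v ∈ V₁ ∨ v ∈ V₂ := fun v => by
    rw [← Finset.mem_union, hunion]; exact Finset.mem_univ v
  constructor
  · intro hx
    exact ⟨stab_restrict G _ x hx, stab_restrict G _ x hx, fun s hs => stab_clique G x hx s hs.1.1⟩
  · rintro ⟨h1, h2, h3⟩
    have hnn : ∀ v, 0 ≤ x v := by
      intro v
      rcases hcov v with hv | hv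
      · exact stab_nonneg _ _ h1 ⟨v, hv⟩
      · exact stab_nonneg _ _ h2 ⟨v, hv⟩
    refine mem_stab_of_clique G hG x hnn fun K hK => ?_
    obtain ⟨M, hM, hKM⟩ := exists_maxClique G K hK
    refine (Finset.sum_le_sum_of_subset_of_nonneg hKM fun v _ _ => hnn v).trans ?_
    by_cases hm1 : ∃ v ∈ M, v ∈ V₁
    · by_cases hm2 : ∃ v ∈ M, v ∈ V₂
      · exact h3 M ⟨hM, hm1, hm2⟩
      · push Not at hm2
        exact clique_of_subset G _ x h1 M hM.1 fun v hv => (hcov v).resolve_right (hm2 v hv)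
    · push Not at hm1
      exact clique_of_subset G _ x h2 M hM.1 fun v hv => (hcov v).resolve_left (hm1 v hv)

end AuxC

/-- for a perfect graph `G` with a vertex partition `V = V₁ ∪ V₂`, letting
`𝒞₁₂` be the set of maximal cliques of `G` meeting both `V₁` and `V₂`,
`xc (STAB G) ≤ xc (STAB G[V₁]) + xc (STAB G[V₂]) + |𝒞₁₂|`. -/
theorem xc_stab_vertex_partition {V : Type*} [Fintype V] [DecidableEq V]
    (G : SimpleGraph V) (hG : IsPerfect G)
    (V₁ V₂ : Finset V) (hunion : V₁ ∪ V₂ = Finset.univ) (hdisj : Disjoint V₁ V₂) :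
    xc (stab G) ≤
      xc (stab (G.induce (V₁ : Set V))) + xc (stab (G.induce (V₂ : Set V))) +
        {s : Finset V |
          IsMaxClique G s ∧ (∃ v ∈ s, v ∈ V₁) ∧ (∃ v ∈ s, v ∈ V₂)}.ncard := by
  classical
  obtain ⟨k₁, Q₁, ⟨hQ₁, π₁, hπ₁⟩, hs₁⟩ := xc_attained _ (stab_polytope (G.induce (V₁ : Set V)))
  obtain ⟨k₂, Q₂, ⟨hQ₂, π₂, hπ₂⟩, hs₂⟩ := xc_attained _ (stab_polytope (G.induce (V₂ : Set V)))
  obtain ⟨f₁, α₁, e₁⟩ := polytope_eq_polyhedron Q₁ hQ₁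
  obtain ⟨f₂, α₂, e₂⟩ := polytope_eq_polyhedron Q₂ hQ₂
  have hc₁ : IsCompact Q₁ := by
    obtain ⟨S, hS, rfl⟩ := hQ₁
    exact hS.isCompact_convexHull ℝ
  have hc₂ : IsCompact Q₂ := by
    obtain ⟨S, hS, rfl⟩ := hQ₂
    exact hS.isCompact_convexHull ℝ
  set C : Set (Finset V) := {s : Finset V |
          IsMaxClique G s ∧ (∃ v ∈ s, v ∈ V₁) ∧ (∃ v ∈ s, v ∈ V₂)} with hC
  have hcov : ∀ v, v ∉ V₁ → v ∈ V₂ := fun v hv => by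
    have : v ∈ V₁ ∪ V₂ := by rw [hunion]; exact Finset.mem_univ v
    exact (Finset.mem_union.1 this).resolve_left hv
  let E := (Fin k₁ → ℝ) × (Fin k₂ → ℝ)
  let p₁ : E →ₗ[ℝ] (Fin k₁ → ℝ) := LinearMap.fst ℝ _ _
  let p₂ : E →ₗ[ℝ] (Fin k₂ → ℝ) := LinearMap.snd ℝ _ _
  let π : E →ₗ[ℝ] (V → ℝ) := LinearMap.pi fun v =>
    if h : v ∈ V₁ then (LinearMap.proj (⟨v, h⟩ : (V₁ : Set V))).comp (π₁.comp p₁)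
    else (LinearMap.proj (⟨v, hcov v h⟩ : (V₂ : Set V))).comp (π₂.comp p₂)
  have hr₁ : ∀ y : E, (fun v : (V₁ : Set V) => π y v) = π₁ y.1 := by
    intro y
    ext ⟨v, hv⟩
    have hv' : v ∈ V₁ := hv
    simp [π, hv']
    rfl
  have hr₂ : ∀ y : E, (fun v : (V₂ : Set V) => π y v) = π₂ y.2 := by
    intro y
    ext ⟨v, hv⟩
    have hv' : v ∉ V₁ := fun h => Finset.disjoint_left.1 hdisj h hv
    simp [π, hv']
    rfl
  let A : AffineSubspace ℝ E := (affineSpan ℝ Q₁).comap p₁.toAffineMap ⊓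
    (affineSpan ℝ Q₂).comap p₂.toAffineMap
  let J := (Fin (polySize Q₁) ⊕ Fin (polySize Q₂)) ⊕ C
  let f : J → E →ₗ[ℝ] ℝ := Sum.elim
    (Sum.elim (fun j => (f₁ j).comp p₁) (fun j => (f₂ j).comp p₂))
    (fun s => (∑ v ∈ s.1, LinearMap.proj v).comp π)
  let α : J → ℝ := Sum.elim (Sum.elim α₁ α₂) (fun _ => 1)
  have hmem : ∀ y : E, y ∈ polyhedron A f α ↔
      y.1 ∈ Q₁ ∧ y.2 ∈ Q₂ ∧ ∀ s ∈ C, ∑ v ∈ s, π y v ≤ 1 := by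
    intro y
    rw [e₁, e₂]
    constructor
    · rintro ⟨⟨ha, hb⟩, h⟩
      refine ⟨⟨ha, fun j => h (Sum.inl (Sum.inl j))⟩, ⟨hb, fun j => h (Sum.inl (Sum.inr j))⟩, ?_⟩
      intro s hs
      simpa [f, α] using h (Sum.inr ⟨s, hs⟩)
    · rintro ⟨⟨ha, ha'⟩, ⟨hb, hb'⟩, h⟩
      refine ⟨⟨ha, hb⟩, ?_⟩
      rintro ((j | j) | ⟨s, hs⟩)
      · exact ha' j
      · exact hb' j
      · simpa [f, α] using h s hs
  have hcompact : IsCompact (polyhedron A f α) := by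
    have hcl : IsClosed {y : E | ∀ s ∈ C, ∑ v ∈ s, π y v ≤ 1} := by
      have hπc : Continuous π := LinearMap.continuous_of_finiteDimensional π
      simp only [Set.ofPred_forall]
      refine isClosed_iInter fun s => isClosed_iInter fun _ => isClosed_le ?_ continuous_const
      exact continuous_finsetSum _ fun v _ => (continuous_apply v).comp hπc
    have : polyhedron A f α = (Q₁ ×ˢ Q₂) ∩ {y : E | ∀ s ∈ C, ∑ v ∈ s, π y v ≤ 1} := by
      ext y
      rw [hmem y]
      exact ⟨fun h => ⟨⟨h.1, h.2.1⟩, h.2.2⟩, fun h => ⟨h.1.1, h.1.2, h.2⟩⟩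
    rw [this]
    exact (hc₁.prod hc₂).inter_right hcl
  have himg : π '' polyhedron A f α = stab G := by
    ext x
    rw [mem_stab_iff G hG V₁ V₂ hunion x]
    constructor
    · rintro ⟨y, hy, rfl⟩
      rw [hmem] at hy
      rw [hr₁, hr₂, ← hπ₁, ← hπ₂]
      exact ⟨⟨_, hy.1, rfl⟩, ⟨_, hy.2.1, rfl⟩, hy.2.2⟩
    · rintro ⟨h1, h2, h3⟩
      rw [← hπ₁] at h1
      rw [← hπ₂] at h2
      obtain ⟨y₁, hy₁, h1⟩ := h1
      obtain ⟨y₂, hy₂, h2⟩ := h2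
      have hx : π (y₁, y₂) = x := by
        ext v
        by_cases hv : v ∈ V₁
        · have a := congrFun (hr₁ (y₁, y₂)) ⟨v, hv⟩
          have b := congrFun h1 ⟨v, hv⟩
          exact a.trans b
        · have a := congrFun (hr₂ (y₁, y₂)) ⟨v, hcov v hv⟩
          have b := congrFun h2 ⟨v, hcov v hv⟩
          exact a.trans b
      refine ⟨(y₁, y₂), (hmem _).2 ⟨hy₁, hy₂, ?_⟩, hx⟩
      rw [hx]
      exact h3
  have hfinal := xc_le_card (stab G) A f α hcompact π himg
  have hcard : Fintype.card J = polySize Q₁ + polySize Q₂ + C.ncard := by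
    simp only [J, Fintype.card_sum, Fintype.card_fin]
    rw [Set.ncard_eq_toFinset_card', Set.toFinset_card]
  rw [hcard, hs₁, hs₂] at hfinal
  exact hfinal
end
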